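/- Suppose a, b, c, d ∈ ℂ[X] are nonconstant and satisfy a ∘ b = c ∘ d and gcd(deg a, deg c) = gcd(deg b, deg d) = 1. Then there are linear ℓ_1, ℓ_2, ℓ_3, ℓ_4 ∈ ℂ[X] such that, after possibly interchanging the pair (a,b) with the pair (c,d), the quadruple (ℓ_1 ∘ a ∘ ℓ_2, ℓ_2^{-1} ∘ b ∘ ℓ_3, ℓ_1 ∘ c ∘ ℓ_4, ℓ_4^{-1} ∘ d ∘ ℓ_3) equals either (T_n, T_m, T_m, T_n) where m, n > 0 are coprime, or (X^n, X^s·h(X^n), X^s·h(X)^n, X^n) where n > 0, s ≥ 0 is coprime to n, and h ∈ ℂ[X] is not divisible by X. -/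

import Mathlib

open Polynomial

/-- The normalized degree-`n` Chebyshev polynomial `T_n`, characterized by
`T_n(Y + 1/Y) = Y^n + 1/Y^n`; it is the Dickson polynomial `D_n(X, 1)`
of the first kind. -/
noncomputable def chebT (n : ℕ) : ℂ[X] :=
  Polynomial.dickson 1 (1 : ℂ) n

/-- There is a polynomial in two variables whose specialization at `x` is the product of the
`Y - d(t)` over the roots `t` of `b - x`. -/
lemma exists_polynomial_map_eval_eq_prod (b d : ℂ[X]) (hb : 0 < b.natDegree) :
    ∃ P : ℂ[X][X], ∀ x : ℂ, P.map (evalRingHom x) =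
      ((b - C x).roots.map fun t => X - C (d.eval t)).prod := by
  have hlc : b.leadingCoeff ≠ 0 := leadingCoeff_ne_zero.2 (by rintro rfl; simp at hb)
  set f : ℂ[X][X][X] := b.map ((C : ℂ[X] →+* ℂ[X][X]).comp C) - C (C X) with hf
  set g : ℂ[X][X][X] := C X - d.map ((C : ℂ[X] →+* ℂ[X][X]).comp C) with hg
  refine ⟨C (C (b.leadingCoeff⁻¹ ^ d.natDegree)) * resultant f g b.natDegree d.natDegree,
    fun x => ?_⟩
  have hcomp : (mapRingHom (evalRingHom x)).comp ((C : ℂ[X] →+* ℂ[X][X]).comp C) =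
      (C : ℂ →+* ℂ[X]) := by
    ext; simp
  have hfx : f.map (mapRingHom (evalRingHom x)) = (b - C x).map C := by
    simp [hf, Polynomial.map_map, hcomp]
  have hgx : g.map (mapRingHom (evalRingHom x)) = C X - d.map C := by
    simp [hg, Polynomial.map_map, hcomp]
  have hres := resultant_map_map f g b.natDegree d.natDegree (mapRingHom (evalRingHom x))
  have hdeg : ((b - C x).map (C : ℂ →+* ℂ[X])).natDegree = b.natDegree := by
    rw [natDegree_map_eq_of_injective C_injective, natDegree_sub_C]
  have hgdeg : (C X - d.map (C : ℂ →+* ℂ[X])).natDegree ≤ d.natDegree := by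
    refine (natDegree_sub_le _ _).trans (by simp)
  have hsplit : (b - C x).Splits := IsAlgClosed.splits _
  have hroots : ((b - C x).map (C : ℂ →+* ℂ[X])).roots = (b - C x).roots.map C := by
    rw [roots_map_of_injective_of_card_eq_natDegree C_injective]
    exact hsplit.natDegree_eq_card_roots.symm
  have hlead : ((b - C x).map (C : ℂ →+* ℂ[X])).leadingCoeff = C b.leadingCoeff := by
    rw [leadingCoeff_map_of_injective C_injective, leadingCoeff, natDegree_sub_C, coeff_sub,
      coeff_C_of_ne_zero hb.ne', sub_zero, leadingCoeff]
  have hprod := resultant_eq_prod_eval _ (C X - d.map (C : ℂ →+* ℂ[X])) _ hgdeg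
    (hsplit.map (C : ℂ →+* ℂ[X]))
  rw [hdeg, hlead, hroots] at hprod
  rw [hfx, hgx, hprod] at hres
  rw [Polynomial.map_mul, map_C, ← coe_mapRingHom, ← hres, Multiset.map_map]
  simp only [coe_evalRingHom, eval_C]
  rw [← mul_assoc, ← C_pow, ← C_mul, ← mul_pow, inv_mul_cancel₀ hlc, one_pow, C_1, one_mul]
  congr 2
  ext1 t
  simp [eval_map, eval₂_at_apply]

/-- If `deg b` and `deg d` are coprime, the powers `1, d, …, d ^ (deg b - 1)` are linearly
independent over `ℂ[b]`. -/
lemma eq_zero_of_sum_comp_mul_pow_eq_zero (b d : ℂ[X]) (hb : 0 < b.natDegree)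
    (hd : 0 < d.natDegree) (hbd : Nat.Coprime b.natDegree d.natDegree) (q : ℕ → ℂ[X])
    (h : ∑ l ∈ Finset.range b.natDegree, (q l).comp b * d ^ l = 0) :
    ∀ l ∈ Finset.range b.natDegree, q l = 0 := by
  have hb0 : b ≠ 0 := by rintro rfl; simp at hb
  have hd0 : d ≠ 0 := by rintro rfl; simp at hd
  have hcomp : ∀ l, (q l).comp b = 0 → q l = 0 := by
    intro l hl
    rcases comp_eq_zero_iff.1 hl with h0 | ⟨-, h1⟩
    · exact h0
    · rw [h1] at hb; simp at hb
  have hpair : Set.Pairwise {i | i ∈ Finset.range b.natDegree ∧ (q i).comp b * d ^ i ≠ 0}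
      (Function.onFun Ne (degree ∘ fun l => (q l).comp b * d ^ l)) := by
    rintro i ⟨hi, hi0⟩ j ⟨hj, hj0⟩ hij heq
    have h2 := natDegree_eq_of_degree_eq heq
    rw [natDegree_mul (left_ne_zero_of_mul hi0) (right_ne_zero_of_mul hi0),
      natDegree_mul (left_ne_zero_of_mul hj0) (right_ne_zero_of_mul hj0), natDegree_comp,
      natDegree_comp, natDegree_pow, natDegree_pow] at h2
    have h3 : i * d.natDegree ≡ j * d.natDegree [MOD b.natDegree] := by
      have := congrArg (· % b.natDegree) h2
      simpa [Nat.ModEq] using this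
    have h4 := Nat.ModEq.cancel_right_of_coprime hbd h3
    exact hij (Nat.ModEq.eq_of_lt_of_lt h4 (Finset.mem_range.1 hi) (Finset.mem_range.1 hj))
  have hsum := degree_sum_eq_of_disjoint _ _ hpair
  rw [h, degree_zero] at hsum
  intro l hl
  have h1 : degree ((q l).comp b * d ^ l) ≤ ⊥ :=
    hsum ▸ Finset.le_sup (f := fun i => degree ((q i).comp b * d ^ i)) hl
  rw [le_bot_iff, degree_eq_bot] at h1
  exact hcomp l ((mul_eq_zero.1 h1).resolve_right (pow_ne_zero _ hd0))

/-- The fibre product of `a` and `c` is parametrized by `(b, d)`: the values of `d` on the fibre of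
`b` over `x` form the fibre of `c` over `a(x)`. -/
lemma roots_map_eval_eq (a b c d : ℂ[X]) (hb : 0 < b.natDegree) (hd : 0 < d.natDegree)
    (heq : a.comp b = c.comp d) (hbc : b.natDegree = c.natDegree)
    (hbd : Nat.Coprime b.natDegree d.natDegree) (x : ℂ) :
    (b - C x).roots.map d.eval = (c - C (a.eval x)).roots := by
  obtain ⟨P, hP⟩ := exists_polynomial_map_eval_eq_prod b d hb
  have hc0 : c.leadingCoeff ≠ 0 := leadingCoeff_ne_zero.2 (by rintro rfl; simp at hbc; omega)
  set Q : ℂ[X][X] := C (C c.leadingCoeff) * P - (c.map C - C a) with hQ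
  have hQx : ∀ x : ℂ, Q.map (evalRingHom x) = C c.leadingCoeff *
      ((b - C x).roots.map fun t => X - C (d.eval t)).prod - (c - C (a.eval x)) := by
    intro x
    have : (evalRingHom x).comp C = RingHom.id ℂ := by ext; simp
    simp [hQ, hP, Polynomial.map_map, this]
  have hmonic : ∀ x : ℂ, ((b - C x).roots.map fun t => X - C (d.eval t)).prod.Monic :=
    fun x => monic_multiset_prod_of_monic _ _ fun t _ => monic_X_sub_C _
  have hcard : ∀ x : ℂ,
      ((b - C x).roots.map fun t => X - C (d.eval t)).prod.natDegree = c.natDegree := by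
    intro x
    rw [natDegree_multiset_prod_of_monic _ (fun f hf => by
      obtain ⟨t, -, rfl⟩ := Multiset.mem_map.1 hf; exact monic_X_sub_C _), Multiset.map_map]
    simp only [Function.comp_def, natDegree_X_sub_C, Multiset.map_const', Multiset.sum_replicate,
      smul_eq_mul, mul_one]
    rw [← (IsAlgClosed.splits (b - C x)).natDegree_eq_card_roots, natDegree_sub_C, hbc]
  have hcoeff : ∀ k, b.natDegree ≤ k → Q.coeff k = 0 := by
    intro k hk
    refine Polynomial.funext fun x => ?_
    have h1 : (Q.coeff k).eval x = (Q.map (evalRingHom x)).coeff k := by simp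
    rw [h1, hQx, coeff_sub, coeff_C_mul, coeff_sub, coeff_C_of_ne_zero (by omega), eval_zero]
    rcases hk.eq_or_lt with rfl | hlt
    · have h2 := (hmonic x).coeff_natDegree
      rw [hcard x] at h2
      rw [hbc, h2, leadingCoeff]; ring
    · rw [coeff_eq_zero_of_natDegree_lt (by rw [hcard]; omega),
        coeff_eq_zero_of_natDegree_lt (by omega)]
      ring
  have hdegQ : Q.natDegree < b.natDegree := by
    by_contra! hlt
    have h0 : Q = 0 := leadingCoeff_eq_zero.1 (hcoeff _ hlt)
    rw [h0] at hlt; simp at hlt; omega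
  have hsum : ∑ l ∈ Finset.range b.natDegree, (Q.coeff l).comp b * d ^ l = 0 := by
    refine Polynomial.funext fun t => ?_
    have h1 : (Q.map (evalRingHom (b.eval t))).eval (d.eval t) = 0 := by
      rw [hQx, eval_sub, eval_mul, eval_multiset_prod, Multiset.map_map]
      have hmem : t ∈ (b - C (b.eval t)).roots := by
        rw [mem_roots_sub_C']
        refine ⟨?_, rfl⟩
        rintro h; rw [h] at hb; simp at hb
      rw [Multiset.prod_eq_zero (Multiset.mem_map.2 ⟨t, hmem, by simp⟩)]
      have := congrArg (eval t) heq
      simp only [eval_comp] at this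
      simp [this]
    rw [eval_eq_sum_range' (lt_of_le_of_lt natDegree_map_le hdegQ)] at h1
    rw [eval_zero, ← h1, eval_finsetSum]
    refine Finset.sum_congr rfl fun l _ => ?_
    simp [eval_comp]
  have hzero := eq_zero_of_sum_comp_mul_pow_eq_zero b d hb hd hbd (fun l => Q.coeff l) hsum
  have hQ0 : Q = 0 := by
    ext1 k
    by_cases hk : k < b.natDegree
    · simpa using hzero k (Finset.mem_range.2 hk)
    · simpa using hcoeff k (not_lt.1 hk)
  have hfin := hQx x
  rw [hQ0, Polynomial.map_zero, eq_comm, sub_eq_zero] at hfin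
  rw [← hfin, roots_C_mul _ hc0]
  have h1 : ((b - C x).roots.map fun t => X - C (d.eval t)) =
      ((b - C x).roots.map d.eval).map fun y => X - C y := by
    rw [Multiset.map_map]; rfl
  rw [h1, roots_multiset_prod_X_sub_C]

/-- The ramification index of the polynomial map `a` at `x`. -/
noncomputable def ramIdx (a : ℂ[X]) (x : ℂ) : ℕ := (a - C (a.eval x)).rootMultiplicity x

/-- The fibre of the polynomial map `a` over `z`. -/
noncomputable def fibre (a : ℂ[X]) (z : ℂ) : Finset ℂ := (a - C z).roots.toFinset

section

variable {a : ℂ[X]}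

lemma sub_C_ne_zero_of_natDegree_pos (ha : 0 < a.natDegree) (z : ℂ) : a - C z ≠ 0 := by
  intro h
  have := natDegree_sub_C (p := a) (a := z)
  rw [h] at this
  simp at this
  omega

lemma mem_fibre (ha : 0 < a.natDegree) {x z : ℂ} : x ∈ fibre a z ↔ a.eval x = z := by
  rw [fibre, Multiset.mem_toFinset, mem_roots (sub_C_ne_zero_of_natDegree_pos ha z)]
  simp [sub_eq_zero]

lemma ramIdx_pos (ha : 0 < a.natDegree) (x : ℂ) : 0 < ramIdx a x := by
  rw [ramIdx, rootMultiplicity_pos (sub_C_ne_zero_of_natDegree_pos ha _)]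
  simp

lemma sum_ramIdx (ha : 0 < a.natDegree) (z : ℂ) :
    ∑ x ∈ fibre a z, ramIdx a x = a.natDegree := by
  rw [← natDegree_sub_C (a := z), (IsAlgClosed.splits (a - C z)).natDegree_eq_card_roots,
    ← Multiset.toFinset_sum_count_eq]
  refine Finset.sum_congr rfl fun x hx => ?_
  rw [count_roots, ramIdx, (mem_fibre ha).1 hx]

lemma ramIdx_sub_one (x : ℂ) : ramIdx a x - 1 = (derivative a).rootMultiplicity x := by
  have h := derivative_rootMultiplicity_of_root (p := a - C (a.eval x)) (t := x) (by simp)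
  rw [ramIdx, ← h]
  simp

lemma sum_ramIdx_sub_one_le (a : ℂ[X]) (s : Finset ℂ) :
    ∑ x ∈ s, (ramIdx a x - 1) ≤ a.natDegree - 1 := by
  classical
  refine le_trans ?_ (((derivative a).card_roots').trans (natDegree_derivative_le a))
  rw [← Multiset.toFinset_sum_count_eq]
  simp only [ramIdx_sub_one, count_roots]
  refine Finset.sum_le_sum_of_ne_zero fun x _ hx => ?_
  rw [Multiset.mem_toFinset, ← Multiset.count_pos, count_roots]
  omega

lemma pairwiseDisjoint_fibre (ha : 0 < a.natDegree) (s : Set ℂ) :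
    s.PairwiseDisjoint (fibre a) := by
  intro z _ w _ hzw
  rw [Function.onFun, Finset.disjoint_left]
  intro x hx hxw
  exact hzw (((mem_fibre ha).1 hx).symm.trans ((mem_fibre ha).1 hxw))

/-- The Riemann–Hurwitz formula for a polynomial map. -/
lemma sum_fibre_ramIdx_sub_one (ha : 0 < a.natDegree) (s : Finset ℂ)
    (hs : ∀ x, (derivative a).IsRoot x → a.eval x ∈ s) :
    ∑ z ∈ s, ∑ x ∈ fibre a z, (ramIdx a x - 1) = a.natDegree - 1 := by
  classical
  rw [← Finset.sum_biUnion (pairwiseDisjoint_fibre ha _)]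
  refine le_antisymm (sum_ramIdx_sub_one_le a _) ?_
  rw [← natDegree_derivative, (IsAlgClosed.splits (derivative a)).natDegree_eq_card_roots,
    ← Multiset.toFinset_sum_count_eq]
  simp only [ramIdx_sub_one, count_roots]
  refine Finset.sum_le_sum_of_subset fun x hx => ?_
  rw [Finset.mem_biUnion]
  exact ⟨_, hs x (isRoot_of_mem_roots (Multiset.mem_toFinset.1 hx)), (mem_fibre ha).2 rfl⟩

end

lemma ramIdx_comp (a b : ℂ[X]) (ha : 0 < a.natDegree) (hb : 0 < b.natDegree) (t : ℂ) :
    ramIdx (a.comp b) t = ramIdx a (b.eval t) * ramIdx b t := by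
  obtain ⟨q, hq, hqr⟩ := exists_eq_pow_rootMultiplicity_mul_and_not_dvd _
    (sub_C_ne_zero_of_natDegree_pos ha (a.eval (b.eval t))) (b.eval t)
  have hcomp : a.comp b - C ((a.comp b).eval t) =
      (b - C (b.eval t)) ^ ramIdx a (b.eval t) * q.comp b := by
    have := congrArg (fun p => p.comp b) hq
    simpa [ramIdx] using this
  have hroot : ¬ (q.comp b).IsRoot t := by
    rw [IsRoot, eval_comp]
    exact fun h => hqr (dvd_iff_isRoot.2 h)
  have hne : a.comp b - C ((a.comp b).eval t) ≠ 0 :=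
    sub_C_ne_zero_of_natDegree_pos (by rw [natDegree_comp]; positivity) _
  rw [ramIdx, hcomp, rootMultiplicity_mul (hcomp ▸ hne), rootMultiplicity_eq_zero hroot, add_zero,
    ← count_roots, roots_pow, Multiset.count_nsmul, count_roots, ramIdx, ramIdx]

lemma sum_ramIdx_filter (a b c d : ℂ[X]) (hb : 0 < b.natDegree)
    (hd : 0 < d.natDegree) (heq : a.comp b = c.comp d) (hbc : b.natDegree = c.natDegree)
    (hbd : Nat.Coprime b.natDegree d.natDegree) {x y : ℂ} (hxy : a.eval x = c.eval y) :
    ∑ t ∈ fibre b x with d.eval t = y, ramIdx b t = ramIdx c y := by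
  classical
  have h := congrArg (Multiset.count y) (roots_map_eval_eq a b c d hb hd heq hbc hbd x)
  rw [count_roots, hxy] at h
  rw [ramIdx, ← h, Multiset.count_map, ← Multiset.toFinset_sum_count_eq]
  rw [Multiset.toFinset_filter]
  simp only [eq_comm (a := y)]
  refine Finset.sum_congr rfl fun t ht => ?_
  rw [Finset.mem_filter] at ht
  rw [Multiset.count_filter_of_pos (p := fun t => eval t d = y) ht.2, count_roots, ramIdx,
    (mem_fibre hb).1 ht.1]

/-- The local contribution to the ramification of `b` at the points over `(x, y)`. -/
lemma sub_gcd_le_sum (a b c d : ℂ[X]) (ha : 0 < a.natDegree) (hb : 0 < b.natDegree)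
    (hc : 0 < c.natDegree) (hd : 0 < d.natDegree) (heq : a.comp b = c.comp d)
    (hbc : b.natDegree = c.natDegree)
    (hbd : Nat.Coprime b.natDegree d.natDegree) {x y : ℂ} (hxy : a.eval x = c.eval y) :
    ramIdx c y - Nat.gcd (ramIdx a x) (ramIdx c y) ≤
      ∑ t ∈ fibre b x with d.eval t = y, (ramIdx b t - 1) := by
  have hsum := sum_ramIdx_filter a b c d hb hd heq hbc hbd hxy
  set s := (fibre b x).filter fun t => d.eval t = y
  set g := Nat.gcd (ramIdx a x) (ramIdx c y) with hg
  have hcy := ramIdx_pos hc y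
  have hg0 : 0 < g := Nat.gcd_pos_of_pos_right _ hcy
  have hle : ∀ t ∈ s, ramIdx c y / g ≤ ramIdx b t := by
    intro t ht
    rw [Finset.mem_filter, mem_fibre hb] at ht
    have h1 := ramIdx_comp a b ha hb t
    rw [heq, ramIdx_comp c d hc hd, ht.1, ht.2] at h1
    refine Nat.le_of_dvd (ramIdx_pos hb t) ?_
    have hcop : Nat.Coprime (ramIdx c y / g) (ramIdx a x / g) :=
      (Nat.coprime_div_gcd_div_gcd hg0).symm
    refine hcop.dvd_of_dvd_mul_left (Dvd.intro (ramIdx d t) ?_)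
    apply Nat.eq_of_mul_eq_mul_left hg0
    rw [← mul_assoc, ← mul_assoc, Nat.mul_div_cancel' (Nat.gcd_dvd_right _ _),
      Nat.mul_div_cancel' (Nat.gcd_dvd_left _ _), h1]
  have hcard : s.card ≤ g := by
    have h1 := Finset.card_nsmul_le_sum s _ _ hle
    rw [hsum, smul_eq_mul] at h1
    have h2 : g * (ramIdx c y / g) = ramIdx c y := Nat.mul_div_cancel' (Nat.gcd_dvd_right _ _)
    have h3 : 0 < ramIdx c y / g :=
      Nat.div_pos (Nat.le_of_dvd hcy (Nat.gcd_dvd_right _ _)) hg0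
    rw [← h2] at h1
    exact Nat.le_of_mul_le_mul_right (by simpa [Nat.mul_div_cancel_left _ hg0] using h1) h3
  rw [Finset.sum_tsub_distrib _ fun t _ => ramIdx_pos hb t, hsum]
  simp only [Finset.sum_const, smul_eq_mul, mul_one]
  omega

/-- The genus-zero constraint on the ramification of `a` and `c`. -/
lemma sum_sub_gcd_le (a b c d : ℂ[X]) (ha : 0 < a.natDegree) (hb : 0 < b.natDegree)
    (hc : 0 < c.natDegree) (hd : 0 < d.natDegree) (heq : a.comp b = c.comp d)
    (hbc : b.natDegree = c.natDegree)
    (hbd : Nat.Coprime b.natDegree d.natDegree) (s : Finset ℂ) :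
    ∑ z ∈ s, ∑ y ∈ fibre c z, ∑ x ∈ fibre a z,
      (ramIdx c y - Nat.gcd (ramIdx a x) (ramIdx c y)) ≤ c.natDegree - 1 := by
  classical
  have h1 : ∀ z ∈ s, ∑ y ∈ fibre c z, ∑ x ∈ fibre a z,
      (ramIdx c y - Nat.gcd (ramIdx a x) (ramIdx c y)) ≤
      ∑ x ∈ fibre a z, ∑ t ∈ fibre b x, (ramIdx b t - 1) := by
    intro z _
    rw [Finset.sum_comm]
    refine Finset.sum_le_sum fun x hx => ?_
    rw [mem_fibre ha] at hx
    have hmaps : ∀ t ∈ fibre b x, d.eval t ∈ fibre c z := by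
      intro t ht
      rw [mem_fibre hb] at ht
      rw [mem_fibre hc, ← hx, ← ht, ← eval_comp, ← eval_comp, heq]
    rw [← Finset.sum_fiberwise_of_maps_to hmaps]
    refine Finset.sum_le_sum fun y hy => ?_
    rw [mem_fibre hc] at hy
    exact sub_gcd_le_sum a b c d ha hb hc hd heq hbc hbd (hx.trans hy.symm)
  refine (Finset.sum_le_sum h1).trans ?_
  rw [← Finset.sum_biUnion (pairwiseDisjoint_fibre ha _),
    ← Finset.sum_biUnion (pairwiseDisjoint_fibre hb _), ← hbc]
  exact sum_ramIdx_sub_one_le b _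

/-- Ramification data over the points `z ∈ s` of two polynomial maps of coprime degrees `n` and `m`
whose fibre product has genus zero: the fibres are `I z` and `J z`, with ramification indices
`e` and `f`. -/
structure IsRamData {ι α β : Type*} (s : Finset ι) (I : ι → Finset α) (J : ι → Finset β)
    (e : α → ℕ) (f : β → ℕ) (n m : ℕ) : Prop where
  coprime : Nat.Coprime n m
  two_le_left : 2 ≤ n
  two_le_right : 2 ≤ m
  pos_left : ∀ z ∈ s, ∀ i ∈ I z, 0 < e i
  pos_right : ∀ z ∈ s, ∀ j ∈ J z, 0 < f j
  sum_left : ∀ z ∈ s, ∑ i ∈ I z, e i = n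
  sum_right : ∀ z ∈ s, ∑ j ∈ J z, f j = m
  ram_left : ∑ z ∈ s, ∑ i ∈ I z, ((e i : ℤ) - 1) = n - 1
  ram_right : ∑ z ∈ s, ∑ j ∈ J z, ((f j : ℤ) - 1) = m - 1
  genus_left : ∑ z ∈ s, ∑ i ∈ I z, ∑ j ∈ J z, ((e i : ℤ) - Nat.gcd (f j) (e i)) ≤ n - 1
  genus_right : ∑ z ∈ s, ∑ j ∈ J z, ∑ i ∈ I z, ((f j : ℤ) - Nat.gcd (e i) (f j)) ≤ m - 1

/-- The ramification type of `(X ^ n, X ^ k * h ^ n)`. -/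
def IsPowerType {ι α β : Type*} (s : Finset ι) (I : ι → Finset α) (J : ι → Finset β)
    (f : β → ℕ) (n : ℕ) : Prop :=
  ∃ z ∈ s, (I z).card = 1 ∧ ∃ j₀ ∈ J z, ∀ j ∈ J z, j ≠ j₀ → n ∣ f j

/-- The ramification type of a pair of Chebyshev polynomials. -/
def IsChebyshevType {ι α β : Type*} (s : Finset ι) (I : ι → Finset α) (J : ι → Finset β)
    (e : α → ℕ) (f : β → ℕ) (n m : ℕ) : Prop :=
  ∃ z ∈ s, ∃ w ∈ s, z ≠ w ∧ ((∀ i ∈ I z, e i ≤ 2) ∧ (∀ i ∈ I w, e i ≤ 2) ∧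
    (I z).card + (I w).card = n + 1) ∧ ((∀ j ∈ J z, f j ≤ 2) ∧ (∀ j ∈ J w, f j ≤ 2) ∧
    (J z).card + (J w).card = m + 1)

lemma add_le_sum_of_ne {α : Type*} {s : Finset α} {g : α → ℤ} (hg : ∀ i ∈ s, 0 ≤ g i) {i j : α}
    (hi : i ∈ s) (hj : j ∈ s) (hij : i ≠ j) : g i + g j ≤ ∑ k ∈ s, g k := by
  classical
  rw [← Finset.sum_pair hij]
  refine Finset.sum_le_sum_of_subset_of_nonneg ?_ fun k hk _ => hg k hk
  intro k hk
  rcases Finset.mem_insert.1 hk with rfl | hk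
  · exact hi
  · rwa [Finset.mem_singleton.1 hk]

lemma gcd_le_cast_right (e : ℕ) {f : ℕ} (hf : 0 < f) : (Nat.gcd e f : ℤ) ≤ f := by
  exact_mod_cast Nat.le_of_dvd hf (Nat.gcd_dvd_right _ _)

lemma gcd_le_cast_left {e : ℕ} (f : ℕ) (he : 0 < e) : (Nat.gcd e f : ℤ) ≤ e := by
  exact_mod_cast Nat.le_of_dvd he (Nat.gcd_dvd_left _ _)

lemma two_mul_gcd_le_of_not_dvd {e f : ℕ} (hf : 0 < f) (h : ¬ f ∣ e) : 2 * Nat.gcd e f ≤ f := by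
  obtain ⟨k, hk⟩ := Nat.gcd_dvd_right e f
  have hk1 : k ≠ 1 := by
    rintro rfl
    rw [mul_one] at hk
    exact h (hk ▸ Nat.gcd_dvd_left e f)
  have hk0 : k ≠ 0 := by rintro rfl; omega
  have : 2 ≤ k := by omega
  calc 2 * Nat.gcd e f ≤ k * Nat.gcd e f := Nat.mul_le_mul_right _ this
    _ = f := by rw [mul_comm]; exact hk.symm

lemma two_sub_mul_sub_one_le {e f : ℕ} (he : 0 < e) (hf : 0 < f) :
    (2 - (e : ℤ)) * ((f : ℤ) - 1) ≤ f - Nat.gcd e f := by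
  rcases Nat.lt_or_ge e 2 with h2 | h2
  · have : e = 1 := by omega
    simp [this]
  · have := gcd_le_cast_right e hf
    have h3 : (2 - (e : ℤ)) * ((f : ℤ) - 1) ≤ 0 :=
      mul_nonpos_of_nonpos_of_nonneg (by omega) (by omega)
    omega

/-- Either `f` fails to divide two of the `e i`, or it divides all but at most one of them. -/
lemma le_sum_sub_gcd_or {α : Type*} {I : Finset α} {e : α → ℕ} {f n : ℕ} (hf : 0 < f)
    (hI : I.Nonempty) (hn : ∑ i ∈ I, e i = n) :
    (f : ℤ) ≤ ∑ i ∈ I, ((f : ℤ) - Nat.gcd (e i) f) ∨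
    ((∀ i ∈ I, Nat.gcd n f ∣ e i) ∧ ∑ i ∈ I, ((f : ℤ) - Nat.gcd (e i) f) = f - Nat.gcd n f ∧
      ∃ i₀ ∈ I, ∀ i ∈ I, i ≠ i₀ → f ∣ e i) := by
  classical
  by_cases h : ∃ i₁ ∈ I, ∃ i₂ ∈ I, i₁ ≠ i₂ ∧ ¬ f ∣ e i₁ ∧ ¬ f ∣ e i₂
  · obtain ⟨i₁, h₁, i₂, h₂, hne, hd₁, hd₂⟩ := h
    left
    refine le_trans ?_ (add_le_sum_of_ne (fun i _ => sub_nonneg.2 (gcd_le_cast_right (e i) hf))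
      h₁ h₂ hne)
    have := two_mul_gcd_le_of_not_dvd hf hd₁
    have := two_mul_gcd_le_of_not_dvd hf hd₂
    omega
  · right
    obtain ⟨i₀, hi₀, hdvd⟩ : ∃ i₀ ∈ I, ∀ i ∈ I, i ≠ i₀ → f ∣ e i := by
      by_cases h' : ∃ i₀ ∈ I, ¬ f ∣ e i₀
      · obtain ⟨i₀, hi₀, hd₀⟩ := h'
        exact ⟨i₀, hi₀, fun i hi hne => by
          by_contra hd; exact h ⟨i, hi, i₀, hi₀, hne, hd, hd₀⟩⟩
      · obtain ⟨i₀, hi₀⟩ := hI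
        exact ⟨i₀, hi₀, fun i hi _ => by by_contra hd; exact h' ⟨i, hi, hd⟩⟩
    have hrest : f ∣ ∑ i ∈ I.erase i₀, e i :=
      Finset.dvd_sum fun i hi => hdvd i (Finset.mem_of_mem_erase hi) (Finset.ne_of_mem_erase hi)
    have hgcd : Nat.gcd n f = Nat.gcd (e i₀) f := by
      rw [← hn, ← Finset.add_sum_erase I e hi₀]
      obtain ⟨k, hk⟩ := hrest
      rw [hk]
      simp
    refine ⟨fun i hi => ?_, ?_, i₀, hi₀, hdvd⟩
    · by_cases hne : i = i₀
      · rw [hgcd, hne]; exact Nat.gcd_dvd_left _ _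
      · exact (Nat.gcd_dvd_right _ _).trans (hdvd i hi hne)
    · rw [← Finset.add_sum_erase I _ hi₀, hgcd, add_eq_left]
      refine Finset.sum_eq_zero fun i hi => ?_
      rw [Nat.gcd_eq_right (hdvd i (Finset.mem_of_mem_erase hi) (Finset.ne_of_mem_erase hi)),
        sub_self]

lemma le_two_sub_add_sum {α : Type*} {I : Finset α} {e : α → ℕ} {f D : ℕ} (hf : 0 < f)
    (hI : 2 ≤ I.card) (h2 : ∀ i ∈ I, 2 ≤ e i) (hD : ∀ i ∈ I, 2 * D ≤ e i)
    (hne : ∃ i ∈ I, e i ≠ 2) :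
    (D : ℤ) ≤ 2 - f + ∑ i ∈ I, ((e i : ℤ) - 2 + (f - Nat.gcd (e i) f)) := by
  obtain ⟨i₁, h₁, hi₁⟩ := hne
  obtain ⟨i₂, h₂, hi₂⟩ := Finset.exists_mem_ne hI i₁
  have hsum := add_le_sum_of_ne (s := I)
    (g := fun i => ((e i : ℤ) - 2 + (f - Nat.gcd (e i) f))) (fun i hi => by
      have := gcd_le_cast_right (e i) hf
      have := h2 i hi
      omega) h₁ h₂ hi₂.symm
  have := gcd_le_cast_right (e i₁) hf
  have := gcd_le_cast_left f (e := e i₂) (by have := h2 i₂ h₂; omega)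
  have := h2 i₁ h₁
  have := hD i₁ h₁
  omega

lemma sum_sub_one_eq {α : Type*} {I : Finset α} {e : α → ℕ} {n : ℕ} (h : ∑ i ∈ I, e i = n) :
    ∑ i ∈ I, ((e i : ℤ) - 1) = n - I.card := by
  rw [Finset.sum_sub_distrib, ← h]; simp

lemma sum_eq_two_mul {α : Type*} {I : Finset α} {e : α → ℕ} {n : ℕ} (h : ∑ i ∈ I, e i = n)
    (h2 : ∀ i ∈ I, e i = 2) : n = 2 * I.card := by
  rw [← h, Finset.sum_congr rfl h2]; simp [mul_comm]

lemma IsChebyshevType.symm {ι α β : Type*} {s : Finset ι} {I : ι → Finset α} {J : ι → Finset β}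
    {e : α → ℕ} {f : β → ℕ} {n m : ℕ} (h : IsChebyshevType s I J e f n m) :
    IsChebyshevType s J I f e m n := by
  obtain ⟨z, hz, w, hw, hzw, h1, h2⟩ := h
  exact ⟨z, hz, w, hw, hzw, h2, h1⟩

section

variable {α β : Type*} {I : Finset α} {J : Finset β} {e : α → ℕ} {f : β → ℕ}

lemma exists_forall_ne_eq (hm : 2 ≤ ∑ j ∈ J, f j)
    (hfe : ∀ j ∈ J, ∃ i₀ ∈ I, ∀ i ∈ I, i ≠ i₀ → f j ∣ e i)
    (hef : ∀ i ∈ I, ∃ j₀ ∈ J, ∀ j ∈ J, j ≠ j₀ → e i ∣ f j)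
    (hnoe : ∀ l : ℕ, l.Prime → ∃ i ∈ I, ¬ l ∣ e i) (hnof : ∀ l : ℕ, l.Prime → ∃ j ∈ J, ¬ l ∣ f j)
    {i₁ : α} (hi₁ : i₁ ∈ I) (h1 : 1 < e i₁) :
    ∃ j₀ ∈ J, ¬ e i₁ ∣ f j₀ ∧ (∃ j ∈ J, j ≠ j₀) ∧ ∀ j ∈ J, j ≠ j₀ → f j = e i₁ := by
  obtain ⟨j₀, hj₀, hdvd⟩ := hef i₁ hi₁
  obtain ⟨l, hl, hle⟩ := Nat.exists_prime_and_dvd h1.ne'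
  refine ⟨j₀, hj₀, fun hd => ?_, ?_, fun j hj hne => ?_⟩
  · obtain ⟨j, hj, hlj⟩ := hnof l hl
    refine hlj (hle.trans ?_)
    by_cases hne : j = j₀
    · rwa [hne]
    · exact hdvd j hj hne
  · by_contra! hall
    have hJ : J = {j₀} := Finset.eq_singleton_iff_unique_mem.2 ⟨hj₀, hall⟩
    rw [hJ, Finset.sum_singleton] at hm
    obtain ⟨k, hk, hkf⟩ := Nat.exists_prime_and_dvd (n := f j₀) (by omega)
    obtain ⟨j, hj, hkj⟩ := hnof k hk
    rw [hall j hj] at hkj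
    exact hkj hkf
  · refine Nat.dvd_antisymm ?_ (hdvd j hj hne)
    obtain ⟨i₀, hi₀, hi⟩ := hfe j hj
    by_cases hi₁₀ : i₁ = i₀
    · exfalso
      obtain ⟨i, hiI, hli⟩ := hnoe l hl
      refine hli (hle.trans ?_)
      by_cases hne' : i = i₀
      · rw [hne', hi₁₀]
      · exact (hdvd j hj hne).trans (hi i hiI hne')
    · exact hi i₁ hi₁ hi₁₀

lemma sum_eq_add_of_forall_ne {i₀ i₁ : α} {u v : ℕ} (h₀ : i₀ ∈ I) (h₁ : i₁ ∈ I) (hne : i₁ ≠ i₀)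
    (huv : u ≠ v) (hu : ∀ i ∈ I, i ≠ i₀ → e i = u) (hv : ∀ i ∈ I, i ≠ i₁ → e i = v) :
    ∑ i ∈ I, e i = u + v := by
  classical
  have hI : I = {i₁, i₀} := by
    ext i
    simp only [Finset.mem_insert, Finset.mem_singleton]
    constructor
    · intro hi
      by_contra! h
      exact huv ((hu i hi h.2).symm.trans (hv i hi h.1))
    · rintro (rfl | rfl) <;> assumption
  rw [hI, Finset.sum_pair hne, hu i₁ h₁ hne, hv i₀ h₀ hne.symm]

lemma exists_eq_one_forall_ne_eq (hn : 2 ≤ ∑ i ∈ I, e i) (hm : 2 ≤ ∑ j ∈ J, f j)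
    (hne : ∑ i ∈ I, e i ≠ ∑ j ∈ J, f j) (hpe : ∀ i ∈ I, 0 < e i) (hpf : ∀ j ∈ J, 0 < f j)
    (hfe : ∀ j ∈ J, ∃ i₀ ∈ I, ∀ i ∈ I, i ≠ i₀ → f j ∣ e i)
    (hef : ∀ i ∈ I, ∃ j₀ ∈ J, ∀ j ∈ J, j ≠ j₀ → e i ∣ f j)
    (hnoe : ∀ l : ℕ, l.Prime → ∃ i ∈ I, ¬ l ∣ e i) (hnof : ∀ l : ℕ, l.Prime → ∃ j ∈ J, ¬ l ∣ f j)
    {i₁ : α} (hi₁ : i₁ ∈ I) (h1 : 1 < e i₁) :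
    ∃ i₀ ∈ I, ∃ j₀ ∈ J, e i₀ = 1 ∧ f j₀ = 1 ∧ (∀ i ∈ I, i ≠ i₀ → e i = e i₁) ∧
      ∀ j ∈ J, j ≠ j₀ → f j = e i₁ := by
  obtain ⟨j₀, hj₀, hd₀, ⟨j₁, hj₁, hj₁₀⟩, hj⟩ :=
    exists_forall_ne_eq hm hfe hef hnoe hnof hi₁ h1
  have hfj₁ := hj j₁ hj₁ hj₁₀
  obtain ⟨i₀, hi₀, hd₀', ⟨i₂, hi₂, hi₂₀⟩, hi⟩ :=
    exists_forall_ne_eq hn hef hfe hnof hnoe hj₁ (hfj₁ ▸ h1)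
  rw [hfj₁] at hd₀' hi
  have hv : f j₀ = 1 := by
    by_contra hv1
    have hv2 : 1 < f j₀ := by have := hpf j₀ hj₀; omega
    obtain ⟨i₃, hi₃, hd₃, -, hi₃'⟩ := exists_forall_ne_eq hn hef hfe hnof hnoe hj₀ hv2
    have hne₃ : i₃ ≠ i₀ := by
      rintro rfl
      exact hd₀ (((hi i₂ hi₂ hi₂₀).symm.trans (hi₃' i₂ hi₂ hi₂₀)).dvd)
    have hw := hi₃' i₀ hi₀ hne₃.symm
    have huv : e i₁ ≠ f j₀ := fun h => hd₀ h.dvd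
    obtain ⟨j₃, hj₃, hd₃', -, hj₃'⟩ :=
      exists_forall_ne_eq hm hfe hef hnoe hnof hi₀ (hw ▸ hv2)
    rw [hw] at hd₃' hj₃'
    have hne₃' : j₃ ≠ j₀ := by
      rintro rfl
      exact hd₃' dvd_rfl
    exact hne ((sum_eq_add_of_forall_ne hi₀ hi₃ hne₃ huv hi hi₃').trans
      (sum_eq_add_of_forall_ne hj₀ hj₃ hne₃' huv hj hj₃').symm)
  refine ⟨i₀, hi₀, j₀, hj₀, ?_, hv, hi, hj⟩
  by_contra hw1
  have hw2 : 1 < e i₀ := by have := hpe i₀ hi₀; omega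
  obtain ⟨j₃, hj₃, hd₃, -, hj₃'⟩ := exists_forall_ne_eq hm hfe hef hnoe hnof hi₀ hw2
  by_cases h : j₃ = j₀
  · have := hj₃' j₁ hj₁ (h ▸ hj₁₀)
    exact hd₀' ((hfj₁.symm.trans this).dvd)
  · have := hj₃' j₀ hj₀ (Ne.symm h)
    omega

lemma sum_eq_one_add_mul {i₀ : α} {u : ℕ} (h₀ : i₀ ∈ I) (h1 : e i₀ = 1)
    (hu : ∀ i ∈ I, i ≠ i₀ → e i = u) : ∑ i ∈ I, e i = 1 + (I.card - 1) * u := by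
  classical
  rw [← Finset.add_sum_erase _ _ h₀, h1, Finset.sum_congr rfl fun i hi =>
    hu i (Finset.mem_of_mem_erase hi) (Finset.ne_of_mem_erase hi)]
  simp [Finset.card_erase_of_mem h₀]

end

namespace IsRamData

variable {ι α β : Type*} {s : Finset ι} {I : ι → Finset α} {J : ι → Finset β}
  {e : α → ℕ} {f : β → ℕ} {n m : ℕ}

lemma symm (h : IsRamData s I J e f n m) : IsRamData s J I f e m n where
  coprime := h.coprime.symm
  two_le_left := h.two_le_right
  two_le_right := h.two_le_left
  pos_left := h.pos_right
  pos_right := h.pos_left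
  sum_left := h.sum_right
  sum_right := h.sum_left
  ram_left := h.ram_right
  ram_right := h.ram_left
  genus_left := h.genus_right
  genus_right := h.genus_left

lemma nonempty_left (h : IsRamData s I J e f n m) {z : ι} (hz : z ∈ s) : (I z).Nonempty := by
  rw [Finset.nonempty_iff_ne_empty]
  intro h0
  have := h.sum_left z hz
  have := h.two_le_left
  simp only [h0, Finset.sum_empty] at *
  omega

lemma card_left_le (h : IsRamData s I J e f n m) {z : ι} (hz : z ∈ s) : (I z).card ≤ n := by
  rw [← h.sum_left z hz, Finset.card_eq_sum_ones]
  exact Finset.sum_le_sum (h.pos_left z hz)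

lemma sum_sub_card (h : IsRamData s I J e f n m) :
    ∑ z ∈ s, ((n : ℤ) - (I z).card) = n - 1 := by
  rw [← h.ram_left]
  exact Finset.sum_congr rfl fun z hz => (sum_sub_one_eq (h.sum_left z hz)).symm

lemma card_add_card_ge (h : IsRamData s I J e f n m) {z w : ι} (hz : z ∈ s) (hw : w ∈ s)
    (hzw : z ≠ w) : n + 1 ≤ (I z).card + (I w).card := by
  have h1 := add_le_sum_of_ne (s := s) (g := fun z => (n : ℤ) - (I z).card)
    (fun z hz => by have := h.card_left_le hz; omega) hz hw hzw
  rw [h.sum_sub_card] at h1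
  omega

lemma sum_two_sub_mul (h : IsRamData s I J e f n m) {w : ι} (hw : w ∈ s) (c : ℤ) :
    ∑ i ∈ I w, (2 - (e i : ℤ)) * c = (2 * (I w).card - n) * c := by
  rw [← Finset.sum_mul, Finset.sum_sub_distrib, ← h.sum_left w hw]
  simp [mul_comm]

lemma card_mul_le_sum_sub_gcd (h : IsRamData s I J e f n m) {w : ι} (hw : w ∈ s) {j : β}
    (hj : j ∈ J w) : (2 * (I w).card - n) * ((f j : ℤ) - 1) ≤
      ∑ i ∈ I w, ((f j : ℤ) - Nat.gcd (e i) (f j)) := by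
  rw [← h.sum_two_sub_mul hw]
  exact Finset.sum_le_sum fun i hi =>
    two_sub_mul_sub_one_le (h.pos_left w hw i hi) (h.pos_right w hw j hj)

lemma mul_le_sum_sub_gcd (h : IsRamData s I J e f n m) {z w : ι} (hz : z ∈ s) (hw : w ∈ s)
    (hzw : w ≠ z) {j : β} (hj : j ∈ J w) :
    ((n : ℤ) - 2 * (I z).card + 2) * ((f j : ℤ) - 1) ≤
      ∑ i ∈ I w, ((f j : ℤ) - Nat.gcd (e i) (f j)) := by
  have hf := h.pos_right w hw j hj
  refine le_trans (mul_le_mul_of_nonneg_right ?_ (by omega)) (h.card_mul_le_sum_sub_gcd hw hj)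
  have := h.card_add_card_ge hw hz hzw
  omega

lemma sum_le (h : IsRamData s I J e f n m) {z : ι} (hz : z ∈ s) :
    ∑ j ∈ J z, ((n : ℤ) - 2 * (I z).card + 2 - f j +
      ∑ i ∈ I z, ((f j : ℤ) - Nat.gcd (e i) (f j))) ≤ n - 2 * (I z).card + 1 := by
  classical
  have h1 := h.genus_right
  have h2 := h.ram_right
  rw [← Finset.add_sum_erase s _ hz] at h1 h2
  have h3 : ∑ w ∈ s.erase z, ((n : ℤ) - 2 * (I z).card + 2) * ∑ j ∈ J w, ((f j : ℤ) - 1) ≤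
      ∑ w ∈ s.erase z, ∑ j ∈ J w, ∑ i ∈ I w, ((f j : ℤ) - Nat.gcd (e i) (f j)) := by
    refine Finset.sum_le_sum fun w hw => ?_
    rw [Finset.mul_sum]
    exact Finset.sum_le_sum fun j hj => h.mul_le_sum_sub_gcd hz (Finset.mem_of_mem_erase hw)
      (Finset.ne_of_mem_erase hw) hj
  rw [← Finset.mul_sum] at h3
  rw [sum_sub_one_eq (h.sum_right z hz)] at h2
  have h4 : ∑ w ∈ s.erase z, ∑ j ∈ J w, ((f j : ℤ) - 1) = (J z).card - 1 := by omega
  rw [h4] at h3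
  rw [Finset.sum_add_distrib, Finset.sum_sub_distrib]
  have h5 : ∑ j ∈ J z, (f j : ℤ) = m := by exact_mod_cast h.sum_right z hz
  rw [h5]
  simp only [Finset.sum_const, nsmul_eq_mul]
  linarith

lemma isPowerType_of_card_eq_one (h : IsRamData s I J e f n m) {z : ι} (hz : z ∈ s)
    (hI : (I z).card = 1) : IsPowerType s I J f n := by
  refine ⟨z, hz, hI, ?_⟩
  have h1 := h.sum_le hz
  obtain ⟨i, hi⟩ := Finset.card_eq_one.1 hI
  have hei : e i = n := by rw [← h.sum_left z hz, hi, Finset.sum_singleton]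
  have h0 := h.two_le_left
  have h2 : ∑ j ∈ J z, ((n : ℤ) - Nat.gcd (f j) n) ≤ n - 1 := by
    refine le_trans (le_of_eq (Finset.sum_congr rfl fun j _ => ?_))
      (h1.trans (by rw [hI]; push_cast; linarith))
    rw [hi, Finset.sum_singleton, hei, Nat.gcd_comm]
    simp
  rcases le_sum_sub_gcd_or (e := f) (f := n) (by omega) (h.symm.nonempty_left hz) rfl with h3 | h3
  · linarith
  · exact h3.2.2

/-- If all the `e i` over `z` are equal to two then the type is that of Chebyshev polynomials. -/
lemma isChebyshevType_of_forall_eq_two (h : IsRamData s I J e f n m) {z : ι} (hz : z ∈ s)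
    (hI : 2 ≤ (I z).card) (h2 : ∀ i ∈ I z, e i = 2) : IsChebyshevType s I J e f n m := by
  classical
  have hn := sum_eq_two_mul (h.sum_left z hz) h2
  set p := (I z).card with hp
  have hle := h.sum_le hz
  have hcol : ∀ j ∈ J z, ∑ i ∈ I z, ((f j : ℤ) - Nat.gcd (e i) (f j)) =
      p * ((f j : ℤ) - Nat.gcd 2 (f j)) := by
    intro j _
    rw [Finset.sum_congr rfl fun i hi => by rw [h2 i hi]]
    rw [Finset.sum_const, nsmul_eq_mul]
  rw [Finset.sum_congr rfl fun j hj => by rw [hcol j hj]] at hle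
  have hp' : (2 : ℤ) ≤ p := by exact_mod_cast hI
  have hodd : ∃ j ∈ J z, ¬ 2 ∣ f j := by
    by_contra! hall
    have hm : 2 ∣ m := h.sum_right z hz ▸ Finset.dvd_sum hall
    have := Nat.dvd_gcd (hn ▸ Dvd.intro _ rfl : 2 ∣ n) hm
    rw [h.coprime] at this
    omega
  obtain ⟨j₀, hj₀, hj₀'⟩ := hodd
  have hgodd : ∀ k : ℕ, ¬ 2 ∣ k → Nat.gcd 2 k = 1 := fun k hk =>
    (Nat.Prime.coprime_iff_not_dvd Nat.prime_two).2 hk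
  have hnonneg : ∀ j ∈ J z, (0 : ℤ) ≤ (n : ℤ) - 2 * p + 2 - f j +
      p * ((f j : ℤ) - Nat.gcd 2 (f j)) := by
    intro j hj
    have := h.pos_right z hz j hj
    by_cases hj2 : 2 ∣ f j
    · rw [Nat.gcd_eq_left hj2]
      have : 2 ≤ f j := Nat.le_of_dvd this hj2
      push_cast
      nlinarith
    · rw [hgodd _ hj2]
      push_cast
      nlinarith
  have hrest := Finset.sum_le_sum_of_subset_of_nonneg
    (Finset.singleton_subset_iff.2 hj₀) fun j hj _ => hnonneg j hj
  rw [Finset.sum_singleton, hgodd _ hj₀'] at hrest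
  have hf₀ : f j₀ = 1 := by
    have := h.pos_right z hz j₀ hj₀
    by_contra hne
    have : (2 : ℤ) ≤ f j₀ := by omega
    push_cast at hrest
    nlinarith
  have hf : ∀ j ∈ J z, j ≠ j₀ → f j = 2 := by
    intro j hj hne
    have hpos := h.pos_right z hz j hj
    have hpair := add_le_sum_of_ne hnonneg hj hj₀ hne
    simp only [hf₀] at hpair
    by_cases hj2 : 2 ∣ f j
    · rw [Nat.gcd_eq_left hj2] at hpair
      have : 2 ≤ f j := Nat.le_of_dvd hpos hj2
      by_contra hne2
      have : (3 : ℤ) ≤ f j := by omega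
      push_cast at hpair
      nlinarith
    · rw [hgodd _ hj2] at hpair
      push_cast at hpair
      nlinarith
  have hfle : ∀ j ∈ J z, f j ≤ 2 := by
    intro j hj
    by_cases hne : j = j₀
    · rw [hne, hf₀]; omega
    · exact (hf j hj hne).le
  have hm : m = 2 * (J z).card - 1 := by
    rw [← h.sum_right z hz, ← Finset.add_sum_erase _ _ hj₀, hf₀,
      Finset.sum_congr rfl fun j hj =>
        hf j (Finset.mem_of_mem_erase hj) (Finset.ne_of_mem_erase hj)]
    have := Finset.card_pos.2 ⟨j₀, hj₀⟩
    simp [Finset.card_erase_of_mem hj₀]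
    omega
  have hm2 := h.two_le_right
  have hram := h.ram_right
  have hgenus := h.genus_right
  rw [← Finset.add_sum_erase s _ hz] at hram hgenus
  rw [sum_sub_one_eq (h.sum_right z hz)] at hram
  have hRz : ∑ j ∈ J z, ∑ i ∈ I z, ((f j : ℤ) - Nat.gcd (e i) (f j)) = 0 := by
    refine Finset.sum_eq_zero fun j hj => ?_
    rw [hcol j hj]
    by_cases hne : j = j₀
    · simp [hne, hf₀]
    · simp [hf j hj hne]
  rw [hRz, zero_add] at hgenus
  have hlow : ∀ w ∈ s.erase z, ∀ j ∈ J w, 2 * ((f j : ℤ) - 1) ≤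
      ∑ i ∈ I w, ((f j : ℤ) - Nat.gcd (e i) (f j)) := by
    intro w hw j hj
    have := h.mul_le_sum_sub_gcd hz (Finset.mem_of_mem_erase hw) (Finset.ne_of_mem_erase hw) hj
    rwa [← hp, hn, show ((2 * p : ℕ) : ℤ) - 2 * p + 2 = 2 by push_cast; ring] at this
  have heq : ∀ w ∈ s.erase z, ∀ j ∈ J w, 2 * ((f j : ℤ) - 1) =
      ∑ i ∈ I w, ((f j : ℤ) - Nat.gcd (e i) (f j)) := by
    have hout : ∀ w ∈ s.erase z, ∑ j ∈ J w, 2 * ((f j : ℤ) - 1) ≤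
        ∑ j ∈ J w, ∑ i ∈ I w, ((f j : ℤ) - Nat.gcd (e i) (f j)) :=
      fun w hw => Finset.sum_le_sum (hlow w hw)
    have htot : ∑ w ∈ s.erase z, ∑ j ∈ J w, 2 * ((f j : ℤ) - 1) =
        ∑ w ∈ s.erase z, ∑ j ∈ J w, ∑ i ∈ I w, ((f j : ℤ) - Nat.gcd (e i) (f j)) := by
      refine le_antisymm (Finset.sum_le_sum hout) (hgenus.trans ?_)
      simp only [← Finset.mul_sum]
      omega
    intro w hw
    exact (Finset.sum_eq_sum_iff_of_le (hlow w hw)).1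
      ((Finset.sum_eq_sum_iff_of_le hout).1 htot w hw)
  -- a second branch point
  obtain ⟨w, hw, j₁, hj₁, hfj₁⟩ : ∃ w ∈ s.erase z, ∃ j ∈ J w, 2 ≤ f j := by
    by_contra! hall
    have : ∑ w ∈ s.erase z, ∑ j ∈ J w, ((f j : ℤ) - 1) = 0 :=
      Finset.sum_eq_zero fun w hw => Finset.sum_eq_zero fun j hj => by
        have := hall w hw j hj
        have := h.pos_right w (Finset.mem_of_mem_erase hw) j hj
        omega
    omega
  have hws := Finset.mem_of_mem_erase hw
  have hwz := Finset.ne_of_mem_erase hw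
  have hcard := h.card_add_card_ge hz hws hwz.symm
  have hsumw := h.sum_left w hws
  have hcardw : (I w).card = p + 1 := by
    have h3 := h.card_mul_le_sum_sub_gcd hws hj₁
    rw [← heq w hw j₁ hj₁] at h3
    have h4 := le_of_mul_le_mul_right h3 (by omega)
    omega
  have hterm : ∀ j ∈ J w, ∀ i ∈ I w, (2 - (e i : ℤ)) * ((f j : ℤ) - 1) =
      f j - Nat.gcd (e i) (f j) := by
    intro j hj
    refine (Finset.sum_eq_sum_iff_of_le fun i hi => two_sub_mul_sub_one_le
      (h.pos_left w hws i hi) (h.pos_right w hws j hj)).1 ?_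
    rw [h.sum_two_sub_mul hws, ← heq w hw j hj, hcardw, hn]
    push_cast
    ring
  have hew : ∀ i ∈ I w, e i ≤ 2 := by
    intro i hi
    have h4 := hterm j₁ hj₁ i hi
    by_contra! hlt
    have := gcd_le_cast_right (e i) (f := f j₁) (by omega)
    have h3 : (2 - (e i : ℤ)) * ((f j₁ : ℤ) - 1) < 0 :=
      mul_neg_of_neg_of_pos (by omega) (by omega)
    omega
  obtain ⟨i₁, hi₁, hei₁⟩ : ∃ i ∈ I w, e i = 2 := by
    by_contra! hall
    have : ∑ i ∈ I w, e i = ∑ i ∈ I w, 1 := Finset.sum_congr rfl fun i hi => by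
      have := hall i hi
      have := hew i hi
      have := h.pos_left w hws i hi
      omega
    rw [h.sum_left w hws] at this
    simp at this
    omega
  have hfw : ∀ j ∈ J w, f j ≤ 2 := by
    intro j hj
    have h4 := hterm j hj i₁ hi₁
    rw [hei₁] at h4
    have := gcd_le_cast_left (e := 2) (f j) (by omega)
    push_cast at h4 this
    omega
  have hcards := h.sum_sub_card
  rw [← Finset.add_sum_erase s _ hz, ← Finset.add_sum_erase _ _ hw] at hcards
  have htriv : ∀ v ∈ (s.erase z).erase w, ∑ j ∈ J v, ((f j : ℤ) - 1) = 0 := by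
    intro v hv
    have hv' := Finset.mem_of_mem_erase hv
    have hvs := Finset.mem_of_mem_erase hv'
    have h0 : (n : ℤ) - (I v).card = 0 := by
      refine (Finset.sum_eq_zero_iff_of_nonneg (f := fun u => (n : ℤ) - (I u).card)
        fun u hu => ?_).1 ?_ v hv
      · have := h.card_left_le (Finset.mem_of_mem_erase (Finset.mem_of_mem_erase hu))
        omega
      · omega
    refine Finset.sum_eq_zero fun j hj => ?_
    have h3 := h.card_mul_le_sum_sub_gcd hvs hj
    rw [← heq v hv' j hj] at h3
    have hpos := h.pos_right v hvs j hj
    by_contra hne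
    have := le_of_mul_le_mul_right h3 (by omega)
    omega
  rw [← Finset.add_sum_erase _ _ hw, Finset.sum_eq_zero htriv,
    sum_sub_one_eq (h.sum_right w hws)] at hram
  exact ⟨z, hz, w, hws, hwz.symm, ⟨fun i hi => (h2 i hi).le, hew, by omega⟩, hfle, hfw, by omega⟩

/-- If the `e i` over `z` have a common prime factor, then the type is that of Chebyshev
polynomials, unless `I z` or `J z` is a singleton. -/
lemma isChebyshevType_of_forall_dvd (h : IsRamData s I J e f n m) {z : ι} (hz : z ∈ s)
    (hI : 2 ≤ (I z).card) (hJ : 2 ≤ (J z).card) {l : ℕ} (hl : l.Prime)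
    (hdvd : ∀ i ∈ I z, l ∣ e i) : IsChebyshevType s I J e f n m := by
  classical
  by_cases h2 : ∀ i ∈ I z, e i = 2
  · exact h.isChebyshevType_of_forall_eq_two hz hI h2
  exfalso
  push Not at h2
  have hle := h.sum_le hz
  have hge2 : ∀ i ∈ I z, 2 ≤ e i := fun i hi =>
    hl.two_le.trans (Nat.le_of_dvd (h.pos_left z hz i hi) (hdvd i hi))
  have htau : ∀ j ∈ J z, (n : ℤ) - 2 * (I z).card + 2 - f j +
      ∑ i ∈ I z, ((f j : ℤ) - Nat.gcd (e i) (f j)) =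
      2 - f j + ∑ i ∈ I z, ((e i : ℤ) - 2 + (f j - Nat.gcd (e i) (f j))) := by
    intro j _
    rw [Finset.sum_add_distrib, Finset.sum_sub_distrib (s := I z) (f := fun i => (e i : ℤ)),
      ← h.sum_left z hz]
    simp
    ring
  have hone : ∀ j ∈ J z, (1 : ℤ) ≤ (n : ℤ) - 2 * (I z).card + 2 - f j +
      ∑ i ∈ I z, ((f j : ℤ) - Nat.gcd (e i) (f j)) := by
    intro j hj
    rw [htau j hj]
    exact_mod_cast le_two_sub_add_sum (D := 1) (h.pos_right z hz j hj) hI hge2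
      (by simpa using hge2) h2
  obtain ⟨j₀, hj₀, hlj₀⟩ : ∃ j ∈ J z, ¬ l ∣ f j := by
    by_contra! hall
    have hm : l ∣ m := h.sum_right z hz ▸ Finset.dvd_sum hall
    have hn : l ∣ n := h.sum_left z hz ▸ Finset.dvd_sum hdvd
    have := Nat.dvd_gcd hn hm
    rw [h.coprime] at this
    exact hl.one_lt.ne' (Nat.dvd_one.1 this)
  obtain ⟨j₁, hj₁, hne⟩ := Finset.exists_mem_ne hJ j₀
  have hpair := add_le_sum_of_ne (fun j hj => zero_le_one.trans (hone j hj)) hj₀ hj₁ hne.symm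
  have hone₁ := hone j₁ hj₁
  rcases le_sum_sub_gcd_or (h.pos_right z hz j₀ hj₀) (h.nonempty_left hz) (h.sum_left z hz) with
    hcol | ⟨hcol, hcol', -⟩
  · linarith
  · have hD : ∀ i ∈ I z, 2 * Nat.gcd n (f j₀) ≤ e i := by
      intro i hi
      have hcop : Nat.Coprime l (Nat.gcd n (f j₀)) :=
        (hl.coprime_iff_not_dvd.2 hlj₀).coprime_dvd_right (Nat.gcd_dvd_right _ _)
      have := Nat.le_of_dvd (h.pos_left z hz i hi)
        (hcop.mul_dvd_of_dvd_of_dvd (hdvd i hi) (hcol i hi))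
      exact (Nat.mul_le_mul_right _ hl.two_le).trans this
    have h3 := le_two_sub_add_sum (h.pos_right z hz j₁ hj₁) hI hge2 hD h2
    rw [← htau j₁ hj₁] at h3
    rw [hcol'] at hpair
    linarith

lemma exists_dvd_of_forall_not_dvd (h : IsRamData s I J e f n m)
    (hno : ∀ z ∈ s, ∀ l : ℕ, l.Prime → ∃ i ∈ I z, ¬ l ∣ e i) :
    ∀ z ∈ s, ∀ j ∈ J z, ∃ i₀ ∈ I z, ∀ i ∈ I z, i ≠ i₀ → f j ∣ e i := by
  have hcol : ∀ z ∈ s, ∀ j ∈ J z, (f j : ℤ) ≤ ∑ i ∈ I z, ((f j : ℤ) - Nat.gcd (e i) (f j)) ∨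
      ((f j : ℤ) - 1 = ∑ i ∈ I z, ((f j : ℤ) - Nat.gcd (e i) (f j)) ∧
        ∃ i₀ ∈ I z, ∀ i ∈ I z, i ≠ i₀ → f j ∣ e i) := by
    intro z hz j hj
    rcases le_sum_sub_gcd_or (h.pos_right z hz j hj) (h.nonempty_left hz) (h.sum_left z hz) with
      h1 | ⟨h1, h2, h3⟩
    · exact Or.inl h1
    · refine Or.inr ⟨?_, h3⟩
      have hD : Nat.gcd n (f j) = 1 := by
        by_contra hne
        obtain ⟨l, hl, hld⟩ := Nat.exists_prime_and_dvd hne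
        obtain ⟨i, hi, hli⟩ := hno z hz l hl
        exact hli (hld.trans (h1 i hi))
      rw [h2, hD]; simp
  have hle : ∀ z ∈ s, ∀ j ∈ J z, (f j : ℤ) - 1 ≤
      ∑ i ∈ I z, ((f j : ℤ) - Nat.gcd (e i) (f j)) := by
    intro z hz j hj
    rcases hcol z hz j hj with h1 | h1
    · omega
    · exact h1.1.le
  have hsum : ∀ z ∈ s, ∑ j ∈ J z, ((f j : ℤ) - 1) ≤
      ∑ j ∈ J z, ∑ i ∈ I z, ((f j : ℤ) - Nat.gcd (e i) (f j)) :=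
    fun z hz => Finset.sum_le_sum (hle z hz)
  have h1 : ∑ z ∈ s, ∑ j ∈ J z, ((f j : ℤ) - 1) ≤
      ∑ z ∈ s, ∑ j ∈ J z, ∑ i ∈ I z, ((f j : ℤ) - Nat.gcd (e i) (f j)) :=
    Finset.sum_le_sum hsum
  have htot := le_antisymm h1 (h.genus_right.trans h.ram_right.ge)
  intro z hz j hj
  have heq := (Finset.sum_eq_sum_iff_of_le (hle z hz)).1
    ((Finset.sum_eq_sum_iff_of_le hsum).1 htot z hz) j hj
  rcases hcol z hz j hj with h1 | h1
  · omega
  · exact h1.2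

lemma isChebyshevType_of_forall_not_dvd (h : IsRamData s I J e f n m)
    (hnoe : ∀ z ∈ s, ∀ l : ℕ, l.Prime → ∃ i ∈ I z, ¬ l ∣ e i)
    (hnof : ∀ z ∈ s, ∀ l : ℕ, l.Prime → ∃ j ∈ J z, ¬ l ∣ f j) :
    IsChebyshevType s I J e f n m := by
  classical
  have hn2 := h.two_le_left
  have hm2 := h.two_le_right
  have hnm : n ≠ m := by
    rintro rfl
    have := h.coprime
    simp at this
    omega
  have hfe := h.exists_dvd_of_forall_not_dvd hnoe
  have hef := h.symm.exists_dvd_of_forall_not_dvd hnof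
  have hloc : ∀ z ∈ s, (I z).card < n → ∃ u, 2 ≤ u ∧ ((∀ i ∈ I z, e i ≤ u) ∧
      n = 1 + ((I z).card - 1) * u) ∧ (∀ j ∈ J z, f j ≤ u) ∧ m = 1 + ((J z).card - 1) * u := by
    intro z hz hlt
    obtain ⟨i₁, hi₁, he₁⟩ : ∃ i ∈ I z, 1 < e i := by
      by_contra! hall
      have := Finset.sum_le_sum hall
      rw [h.sum_left z hz] at this
      simp at this
      omega
    have hsl := h.sum_left z hz
    have hsr := h.sum_right z hz
    obtain ⟨i₀, hi₀, j₀, hj₀, h1, h1', hi, hj⟩ := exists_eq_one_forall_ne_eq (hsl ▸ hn2)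
      (hsr ▸ hm2) (by rwa [hsl, hsr]) (h.pos_left z hz) (h.pos_right z hz) (hfe z hz) (hef z hz)
      (hnoe z hz) (hnof z hz) hi₁ he₁
    refine ⟨e i₁, he₁, ⟨fun i hiI => ?_, ?_⟩, fun j hjJ => ?_, ?_⟩
    · by_cases hne : i = i₀
      · rw [hne, h1]; omega
      · exact (hi i hiI hne).le
    · rw [← sum_eq_one_add_mul hi₀ h1 hi, hsl]
    · by_cases hne : j = j₀
      · rw [hne, h1']; omega
      · exact (hj j hjJ hne).le
    · rw [← sum_eq_one_add_mul hj₀ h1' hj, hsr]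
  have hcards := h.sum_sub_card
  have hpos : ∀ z ∈ s, 0 < (I z).card := fun z hz => Finset.card_pos.2 (h.nonempty_left hz)
  have hhalf : ∀ z ∈ s, (I z).card < n → n + 1 ≥ 2 * (I z).card := by
    intro z hz hlt
    obtain ⟨u, hu, ⟨-, hn⟩, -⟩ := hloc z hz hlt
    have := Nat.mul_le_mul_left ((I z).card - 1) hu
    have := hpos z hz
    omega
  obtain ⟨z, hz, hzn⟩ : ∃ z ∈ s, (I z).card < n := by
    by_contra! hall
    have : ∑ z ∈ s, ((n : ℤ) - (I z).card) ≤ 0 := Finset.sum_nonpos fun z hz => by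
      have := hall z hz
      omega
    omega
  have hz1 : 1 < (I z).card := by
    obtain ⟨u, hu, ⟨-, hn⟩, -⟩ := hloc z hz hzn
    by_contra hle
    rw [show (I z).card - 1 = 0 by omega] at hn
    omega
  obtain ⟨w, hw, hwz, hwn⟩ : ∃ w ∈ s, w ≠ z ∧ (I w).card < n := by
    by_contra! hall
    rw [← Finset.add_sum_erase s _ hz] at hcards
    have : ∑ w ∈ s.erase z, ((n : ℤ) - (I w).card) ≤ 0 := Finset.sum_nonpos fun w hw => by
      have := hall w (Finset.mem_of_mem_erase hw) (Finset.ne_of_mem_erase hw)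
      omega
    omega
  have hcard := h.card_add_card_ge hz hw hwz.symm
  have h3 := hhalf z hz hzn
  have h4 := hhalf w hw hwn
  have htwo : ∀ v ∈ s, (I v).card < n → 2 * (I v).card = n + 1 →
      ((∀ i ∈ I v, e i ≤ 2) ∧ (∀ j ∈ J v, f j ≤ 2) ∧ 2 * (J v).card = m + 1) := by
    intro v hv hvn h5
    obtain ⟨u, hu, ⟨hle, hn⟩, hle', hm⟩ := hloc v hv hvn
    have hu2 : u = 2 := by
      refine le_antisymm ?_ hu
      by_contra! hlt
      have := Nat.mul_le_mul_left ((I v).card - 1) hlt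
      omega
    subst hu2
    exact ⟨hle, hle', by omega⟩
  obtain ⟨a1, a2, a3⟩ := htwo z hz hzn (by omega)
  obtain ⟨b1, b2, b3⟩ := htwo w hw hwn (by omega)
  exact ⟨z, hz, w, hw, hwz.symm, ⟨a1, b1, by omega⟩, a2, b2, by omega⟩

lemma isPowerType_or_isChebyshevType_of_forall_dvd (h : IsRamData s I J e f n m) {z : ι}
    (hz : z ∈ s) {l : ℕ} (hl : l.Prime) (hdvd : ∀ i ∈ I z, l ∣ e i) :
    IsPowerType s I J f n ∨ IsPowerType s J I e m ∨ IsChebyshevType s I J e f n m := by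
  have hI := Finset.card_pos.2 (h.nonempty_left hz)
  have hJ := Finset.card_pos.2 (h.symm.nonempty_left hz)
  by_cases hI1 : (I z).card = 1
  · exact Or.inl (h.isPowerType_of_card_eq_one hz hI1)
  by_cases hJ1 : (J z).card = 1
  · exact Or.inr (Or.inl (h.symm.isPowerType_of_card_eq_one hz hJ1))
  · exact Or.inr (Or.inr (h.isChebyshevType_of_forall_dvd hz (by omega) (by omega) hl hdvd))

/-- The combinatorial core of the second theorem of Ritt. -/
theorem isPowerType_or_isChebyshevType (h : IsRamData s I J e f n m) :
    IsPowerType s I J f n ∨ IsPowerType s J I e m ∨ IsChebyshevType s I J e f n m := by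
  by_cases h1 : ∃ z ∈ s, ∃ l : ℕ, l.Prime ∧ ∀ i ∈ I z, l ∣ e i
  · obtain ⟨z, hz, l, hl, hdvd⟩ := h1
    exact h.isPowerType_or_isChebyshevType_of_forall_dvd hz hl hdvd
  by_cases h2 : ∃ z ∈ s, ∃ l : ℕ, l.Prime ∧ ∀ j ∈ J z, l ∣ f j
  · obtain ⟨z, hz, l, hl, hdvd⟩ := h2
    rcases h.symm.isPowerType_or_isChebyshevType_of_forall_dvd hz hl hdvd with h3 | h3 | h3
    · exact Or.inr (Or.inl h3)
    · exact Or.inl h3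
    · exact Or.inr (Or.inr h3.symm)
  push Not at h1 h2
  exact Or.inr (Or.inr (h.isChebyshevType_of_forall_not_dvd h1 h2))

end IsRamData

/-- The polynomials `U_n` with `(Y - 1/Y) * U_n (Y + 1/Y) = Y ^ n - 1 / Y ^ n`. -/
noncomputable def chebU : ℕ → ℂ[X]
  | 0 => 0
  | 1 => 1
  | n + 2 => X * chebU (n + 1) - chebU n

lemma exists_mul_eq_one_add_eq (t : ℂ) : ∃ x y : ℂ, x * y = 1 ∧ x + y = t := by
  obtain ⟨r, hr⟩ := IsAlgClosed.exists_pow_nat_eq (t ^ 2 - 4) (n := 2) (by norm_num)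
  exact ⟨(t + r) / 2, (t - r) / 2, by linear_combination -hr / 4, by ring⟩

lemma chebT_eval {x y : ℂ} (h : x * y = 1) (n : ℕ) : (chebT n).eval (x + y) = x ^ n + y ^ n :=
  dickson_one_one_eval_add_inv x y h n

lemma chebU_eval {x y : ℂ} (h : x * y = 1) : ∀ n : ℕ,
    (x - y) * (chebU n).eval (x + y) = x ^ n - y ^ n
  | 0 => by simp [chebU]
  | 1 => by simp [chebU]
  | n + 2 => by
    have h1 := chebU_eval h (n + 1)
    have h2 := chebU_eval h n
    simp only [chebU, eval_sub, eval_mul, eval_X]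
    linear_combination (x + y) * h1 - h2 + (x ^ n - y ^ n) * h

lemma chebT_sq_sub_four (n : ℕ) : chebT n ^ 2 - 4 = (X ^ 2 - 4) * chebU n ^ 2 := by
  refine Polynomial.funext fun t => ?_
  obtain ⟨x, y, hxy, rfl⟩ := exists_mul_eq_one_add_eq t
  have h1 := chebU_eval hxy n
  have h2 : x ^ n * y ^ n = 1 := by rw [← mul_pow, hxy, one_pow]
  simp only [eval_sub, eval_mul, eval_pow, eval_X, eval_ofNat, chebT_eval hxy]
  have h3 : (x + y) ^ 2 - 4 = (x - y) ^ 2 := by linear_combination 4 * hxy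
  rw [h3, ← mul_pow, h1]
  linear_combination 4 * h2

lemma chebT_comp_neg_X (n : ℕ) : (chebT n).comp (-X) = (-1) ^ n * chebT n := by
  refine Polynomial.funext fun t => ?_
  obtain ⟨x, y, hxy, rfl⟩ := exists_mul_eq_one_add_eq t
  rw [eval_comp, eval_neg, eval_X, neg_add, chebT_eval (by rw [neg_mul_neg, hxy])]
  simp [chebT_eval hxy, neg_pow x, neg_pow y, mul_add]

lemma natDegree_chebT {n : ℕ} (hn : 0 < n) : (chebT n).natDegree = n := by
  have key : ∀ n : ℕ, (chebT (n + 1)).Monic ∧ (chebT (n + 1)).natDegree = n + 1 := by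
    intro n
    induction n using Nat.strong_induction_on with
    | _ n ih =>
      match n with
      | 0 => simp [chebT, monic_X]
      | 1 =>
        have : chebT 2 = X ^ 2 - C 2 := by
          simp [chebT, map_ofNat]; ring
        rw [this]
        exact ⟨monic_X_pow_sub_C _ (by norm_num), natDegree_X_pow_sub_C⟩
      | k + 2 =>
        obtain ⟨h1, h2⟩ := ih (k + 1) (by omega)
        obtain ⟨h3, h4⟩ := ih k (by omega)
        have hrec : chebT (k + 2 + 1) = X * chebT (k + 1 + 1) - chebT (k + 1) := by
          simp [chebT, dickson_add_two]
        have hm : (X * chebT (k + 1 + 1)).Monic := monic_X.mul h1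
        have hd : (X * chebT (k + 1 + 1)).natDegree = k + 3 := by
          rw [natDegree_X_mul h1.ne_zero, h2]
        have hlt : (chebT (k + 1)).natDegree < (X * chebT (k + 1 + 1)).natDegree := by
          rw [hd, h4]; omega
        rw [hrec]
        exact ⟨hm.sub_of_left (degree_lt_degree hlt), by
          rw [natDegree_sub_eq_left_of_natDegree_lt hlt, hd]⟩
  obtain ⟨k, rfl⟩ := Nat.exists_eq_succ_of_ne_zero hn.ne'
  exact (key k).2

lemma natDegree_sq_sub_four (a : ℂ[X]) :
    (a ^ 2 - 4).natDegree = 2 * a.natDegree := by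
  rw [show (4 : ℂ[X]) = C 4 from (map_ofNat C 4).symm, natDegree_sub_C, natDegree_pow]

lemma natDegree_eq_of_sq_sub_four_eq {a g : ℂ[X]} (ha : 0 < a.natDegree)
    (h : a ^ 2 - 4 = (X ^ 2 - 4) * g ^ 2) : a.natDegree = g.natDegree + 1 ∧ g ≠ 0 := by
  have h1 := natDegree_sq_sub_four a
  have hg : g ≠ 0 := by
    rintro rfl
    rw [h] at h1
    simp at h1
    omega
  have hX : (X ^ 2 - 4 : ℂ[X]).natDegree = 2 := by
    rw [natDegree_sq_sub_four, natDegree_X]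
  have hX0 : (X ^ 2 - 4 : ℂ[X]) ≠ 0 := by
    intro h0; rw [h0] at hX; simp at hX
  rw [h, natDegree_mul hX0 (pow_ne_zero 2 hg), natDegree_pow, hX] at h1
  exact ⟨by omega, hg⟩

/-- Polynomial solutions of the Pell equation `a ^ 2 - (X ^ 2 - 4) * g ^ 2 = 4`. -/
lemma eq_chebT_or_eq_neg_chebT {a g : ℂ[X]} (ha : 0 < a.natDegree)
    (h : a ^ 2 - 4 = (X ^ 2 - 4) * g ^ 2) :
    a = chebT a.natDegree ∨ a = -chebT a.natDegree := by
  set n := a.natDegree with hn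
  have hT := natDegree_chebT ha
  have hTU := chebT_sq_sub_four n
  obtain ⟨hg, hg0⟩ := natDegree_eq_of_sq_sub_four_eq ha h
  obtain ⟨hU, hU0⟩ := natDegree_eq_of_sq_sub_four_eq (ha.trans_eq hT.symm) hTU
  rw [hT] at hU
  have ha0 : a ≠ 0 := ne_zero_of_natDegree_gt ha
  have hprod : (a * chebU n - chebT n * g) * (a * chebU n + chebT n * g) =
      C 4 * (chebU n ^ 2 - g ^ 2) := by
    rw [map_ofNat]
    linear_combination chebU n ^ 2 * h - g ^ 2 * hTU
  have hsq : chebU n ^ 2 - g ^ 2 = 0 := by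
    by_contra hne
    have h0 : (a * chebU n - chebT n * g) * (a * chebU n + chebT n * g) ≠ 0 := by
      rw [hprod]
      exact mul_ne_zero (C_ne_zero.2 (by norm_num)) hne
    have hdeg : ((a * chebU n - chebT n * g) * (a * chebU n + chebT n * g)).natDegree ≤
        2 * (n - 1) := by
      rw [hprod, natDegree_C_mul (by norm_num)]
      refine (natDegree_sub_le _ _).trans (max_le ?_ ?_) <;> rw [natDegree_pow] <;> omega
    rw [natDegree_mul (left_ne_zero_of_mul h0) (right_ne_zero_of_mul h0)] at hdeg
    have hsum : (C 2 * (a * chebU n)).natDegree = n + (n - 1) := by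
      rw [natDegree_C_mul (by norm_num), natDegree_mul ha0 hU0]
      omega
    rw [show C 2 * (a * chebU n) = (a * chebU n - chebT n * g) + (a * chebU n + chebT n * g) by
      rw [map_ofNat]; ring] at hsum
    have := natDegree_add_le (a * chebU n - chebT n * g) (a * chebU n + chebT n * g)
    omega
  exact sq_eq_sq_iff_eq_or_eq_neg.1 (by linear_combination h - hTU - (X ^ 2 - 4) * hsq)

/-- The equation `T_n ∘ b = T_m ∘ d` with `m` and `n` coprime. -/
lemma exists_comp_eq_of_chebT_comp_eq {b d : ℂ[X]} {m n : ℕ} (hn : 0 < n) (hm : 0 < m)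
    (hmn : Nat.Coprime n m) (hb : b.natDegree = m)
    (heq : (chebT n).comp b = (chebT m).comp d) :
    ∃ l : ℂ[X], l.natDegree = 1 ∧ b = (chebT m).comp l ∧ d = (chebT n).comp l := by
  have hsq : (b ^ 2 - 4) * ((chebU n).comp b) ^ 2 = (d ^ 2 - 4) * ((chebU m).comp d) ^ 2 := by
    have h1 := congrArg (fun p => p.comp b) (chebT_sq_sub_four n)
    have h2 := congrArg (fun p => p.comp d) (chebT_sq_sub_four m)
    simp only [sub_comp, pow_comp, mul_comp, X_comp, ofNat_comp, Nat.cast_ofNat] at h1 h2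
    rw [← h1, ← h2, heq]
  obtain ⟨Δ, hΔ⟩ : (chebU n).comp b ∣ (d ^ 2 - 4) * (chebU m).comp d := by
    refine (UniqueFactorizationMonoid.pow_dvd_pow_iff_dvd two_ne_zero).1
      (Dvd.intro ((b ^ 2 - 4) * (d ^ 2 - 4)) ?_)
    linear_combination (d ^ 2 - 4) * hsq
  have hU : (chebU n).comp b ≠ 0 := by
    intro h0
    rw [comp_eq_zero_iff] at h0
    obtain ⟨-, hU0⟩ := natDegree_eq_of_sq_sub_four_eq (hn.trans_eq (natDegree_chebT hn).symm)
      (chebT_sq_sub_four n)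
    rcases h0 with h0 | ⟨-, h0⟩
    · exact hU0 h0
    · rw [h0, natDegree_C] at hb
      omega
  obtain ⟨u, v, huv⟩ : ∃ u v : ℕ, u * n = v * m + 1 := by
    rcases Nat.lt_or_ge 1 m with h1 | h1
    · obtain ⟨u, -, hu⟩ := Nat.exists_mul_mod_eq_one_of_coprime hmn h1
      refine ⟨u, n * u / m, ?_⟩
      have := Nat.div_add_mod (n * u) m
      rw [hu] at this
      rw [mul_comm u, mul_comm _ m, this]
    · exact ⟨1, n - 1, by rw [show m = 1 by omega]; omega⟩
  set l : ℂ[X] := C (1 / 2) * ((chebT u).comp d * (chebT v).comp b -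
    (chebU u).comp d * (chebU v).comp b * Δ) with hl
  have hpt : ∀ t : ℂ, ((chebU n).comp b).eval t ≠ 0 →
      b.eval t = ((chebT m).comp l).eval t ∧ d.eval t = ((chebT n).comp l).eval t := by
    intro t ht
    obtain ⟨β, β', hβ, hbt⟩ := exists_mul_eq_one_add_eq (b.eval t)
    have hval := congrArg (eval t) heq
    have hΔt := congrArg (eval t) hΔ
    simp only [eval_comp, eval_mul, eval_sub, eval_pow, eval_ofNat] at hval hΔt ht
    rw [← hbt] at hval hΔt ht
    rw [chebT_eval hβ] at hval
    have hUb := chebU_eval hβ n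
    have hβn : β ^ n * β' ^ n = 1 := by rw [← mul_pow, hβ, one_pow]
    obtain ⟨δ, δ', hδ, hdt, hδm⟩ : ∃ δ δ' : ℂ, δ * δ' = 1 ∧ δ + δ' = d.eval t ∧
        β ^ n = δ ^ m := by
      obtain ⟨δ, δ', hδ, hdt⟩ := exists_mul_eq_one_add_eq (d.eval t)
      rw [← hdt, chebT_eval hδ] at hval
      have hδm : δ ^ m * δ' ^ m = 1 := by rw [← mul_pow, hδ, one_pow]
      have hz : (β ^ n - δ ^ m) * (β ^ n - δ' ^ m) = 0 := by
        linear_combination β ^ n * hval + hδm - hβn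
      rcases mul_eq_zero.1 hz with h0 | h0
      · exact ⟨δ, δ', hδ, hdt, sub_eq_zero.1 h0⟩
      · exact ⟨δ', δ, by rw [mul_comm, hδ], by rw [add_comm, hdt], sub_eq_zero.1 h0⟩
    rw [← hdt] at hΔt
    have hUd := chebU_eval hδ m
    have hδm' : β' ^ n = δ' ^ m := by
      have hδm2 : δ ^ m * δ' ^ m = 1 := by rw [← mul_pow, hδ, one_pow]
      have : β ^ n ≠ 0 := left_ne_zero_of_mul_eq_one hβn
      refine mul_left_cancel₀ this ?_
      rw [hβn, hδm, hδm2]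
    -- the square root `Δ` of `(b ^ 2 - 4) * (d ^ 2 - 4)`
    have hΔ' : Δ.eval t = (β - β') * (δ - δ') := by
      refine mul_left_cancel₀ ht ?_
      rw [← hΔt]
      have h3 : (δ + δ') ^ 2 - 4 = (δ - δ') ^ 2 := by linear_combination 4 * hδ
      rw [h3]
      linear_combination (δ - δ') * hUd - (δ - δ') * hUb - (δ - δ') * hδm + (δ - δ') * hδm'
    have hlt : l.eval t = δ ^ u * β' ^ v + δ' ^ u * β ^ v := by
      have h4 := chebU_eval hδ u
      have h5 := chebU_eval hβ v
      simp only [hl, eval_mul, eval_C, eval_sub, eval_comp, hΔ', ← hbt, ← hdt, chebT_eval hδ,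
        chebT_eval hβ]
      linear_combination -(1 / 2) * ((β - β') * (chebU v).eval (β + β')) * h4
        - (1 / 2) * (δ ^ u - δ' ^ u) * h5
    have hη : (δ ^ u * β' ^ v) * (δ' ^ u * β ^ v) = 1 := by
      rw [show (δ ^ u * β' ^ v) * (δ' ^ u * β ^ v) = (δ * δ') ^ u * (β * β') ^ v by
        simp only [mul_pow]; ring, hδ, hβ]
      simp
    have haux : ∀ x x' y y' : ℂ, x * x' = 1 → y * y' = 1 → x ^ n = y ^ m → x' ^ n = y' ^ m →
        (y ^ u * x' ^ v) ^ m = x ∧ (y ^ u * x' ^ v) ^ n = y := by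
      intro x x' y y' hx hy h1 h2
      constructor
      · calc (y ^ u * x' ^ v) ^ m = (y ^ m) ^ u * x' ^ (v * m) := by
              rw [mul_pow, ← pow_mul, ← pow_mul, ← pow_mul, mul_comm u m]
          _ = x * (x * x') ^ (v * m) := by
              rw [← h1, ← pow_mul, mul_comm n u, huv, mul_pow]; ring
          _ = x := by rw [hx]; simp
      · calc (y ^ u * x' ^ v) ^ n = y ^ (u * n) * (x' ^ n) ^ v := by
              rw [mul_pow, ← pow_mul, ← pow_mul, ← pow_mul, mul_comm v n]
          _ = y * (y * y') ^ (v * m) := by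
              rw [h2, ← pow_mul, mul_comm m v, huv, mul_pow]; ring
          _ = y := by rw [hy]; simp
    obtain ⟨e1, e2⟩ := haux β β' δ δ' hβ hδ hδm hδm'
    obtain ⟨e3, e4⟩ := haux β' β δ' δ (by rw [mul_comm, hβ]) (by rw [mul_comm, hδ]) hδm' hδm
    rw [eval_comp, eval_comp, hlt, chebT_eval hη, chebT_eval hη, e1, e2, e3, e4]
    exact ⟨hbt.symm, hdt.symm⟩
  have hinf : {t : ℂ | ((chebU n).comp b).eval t ≠ 0}.Infinite := by
    have := ((chebU n).comp b).roots.toFinset.finite_toSet.infinite_compl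
    refine this.mono ?_
    intro t ht h0
    exact ht (by simpa [hU] using h0)
  have hbl : b = (chebT m).comp l :=
    eq_of_infinite_eval_eq _ _ (hinf.mono fun t ht => (hpt t ht).1)
  refine ⟨l, ?_, hbl, eq_of_infinite_eval_eq _ _ (hinf.mono fun t ht => (hpt t ht).2)⟩
  have hdeg := congrArg natDegree hbl
  rw [natDegree_comp, natDegree_chebT hm, hb] at hdeg
  exact Nat.eq_of_mul_eq_mul_left hm (by omega)

/-- Equivalence of solutions of `a ∘ b = c ∘ d` under linear changes of variables. -/
def RittEquiv (a b c d a' b' c' d' : ℂ[X]) : Prop :=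
  ∃ ℓ₁ ℓ₂ ℓ₂inv ℓ₃ ℓ₄ ℓ₄inv : ℂ[X],
    ℓ₁.natDegree = 1 ∧ ℓ₂.natDegree = 1 ∧ ℓ₃.natDegree = 1 ∧ ℓ₄.natDegree = 1 ∧
    ℓ₂.comp ℓ₂inv = X ∧ ℓ₂inv.comp ℓ₂ = X ∧ ℓ₄.comp ℓ₄inv = X ∧ ℓ₄inv.comp ℓ₄ = X ∧
    ℓ₁.comp (a.comp ℓ₂) = a' ∧ ℓ₂inv.comp (b.comp ℓ₃) = b' ∧
    ℓ₁.comp (c.comp ℓ₄) = c' ∧ ℓ₄inv.comp (d.comp ℓ₃) = d'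

lemma exists_comp_eq_X {l : ℂ[X]} (hl : l.natDegree = 1) :
    ∃ l' : ℂ[X], l.comp l' = X ∧ l'.comp l = X ∧ l'.natDegree = 1 := by
  obtain ⟨u, hu, v, rfl⟩ := natDegree_eq_one.1 hl
  refine ⟨C u⁻¹ * X - C (u⁻¹ * v), ?_, ?_, ?_⟩
  · simp only [add_comp, mul_comp, C_comp, X_comp, mul_sub, ← mul_assoc, ← C_mul,
      mul_inv_cancel₀ hu, C_1, one_mul, sub_add_cancel]
  · simp only [sub_comp, mul_comp, C_comp, X_comp, mul_add, ← mul_assoc, ← C_mul,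
      inv_mul_cancel₀ hu, C_1, one_mul, add_sub_cancel_right]
  · rw [natDegree_sub_C, natDegree_C_mul_X _ (inv_ne_zero hu)]

lemma natDegree_eq_one_of_comp_eq_X {l l' : ℂ[X]} (h : l.comp l' = X) : l'.natDegree = 1 := by
  have := congrArg natDegree h
  rw [natDegree_comp, natDegree_X] at this
  exact Nat.eq_one_of_mul_eq_one_left this

namespace RittEquiv

variable {a b c d a' b' c' d' a'' b'' c'' d'' : ℂ[X]}

lemma trans (h : RittEquiv a b c d a' b' c' d') (h' : RittEquiv a' b' c' d' a'' b'' c'' d'') :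
    RittEquiv a b c d a'' b'' c'' d'' := by
  obtain ⟨k₁, k₂, k₂i, k₃, k₄, k₄i, e₁, e₂, e₃, e₄, f₁, f₂, f₃, f₄, rfl, rfl, rfl, rfl⟩ := h
  obtain ⟨l₁, l₂, l₂i, l₃, l₄, l₄i, g₁, g₂, g₃, g₄, h₁, h₂, h₃, h₄, rfl, rfl, rfl, rfl⟩ := h'
  have aux : ∀ {p q r t : ℂ[X]}, p.comp q = X → r.comp t = X → (p.comp r).comp (t.comp q) = X := by
    intro p q r t h1 h2
    rw [comp_assoc, ← comp_assoc r, h2, X_comp, h1]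
  refine ⟨l₁.comp k₁, k₂.comp l₂, l₂i.comp k₂i, k₃.comp l₃, k₄.comp l₄, l₄i.comp k₄i,
    ?_, ?_, ?_, ?_, aux f₁ h₁, aux h₂ f₂, aux f₃ h₃, aux h₄ f₄, ?_, ?_, ?_, ?_⟩
  iterate 4 rw [natDegree_comp]; simp [*]
  all_goals simp only [comp_assoc]

lemma left (a b c d : ℂ[X]) {l : ℂ[X]} (hl : l.natDegree = 1) :
    RittEquiv a b c d (l.comp a) b (l.comp c) d :=
  ⟨l, X, X, X, X, X, by simp [hl]⟩

lemma right (a b c d : ℂ[X]) {l : ℂ[X]} (hl : l.natDegree = 1) :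
    RittEquiv a b c d a (b.comp l) c (d.comp l) :=
  ⟨X, X, X, l, X, X, by simp [hl]⟩

lemma mid (a b c d : ℂ[X]) {l k : ℂ[X]} (hl : l.natDegree = 1) (hk : k.natDegree = 1) :
    ∃ b' d', RittEquiv a b c d (a.comp l) b' (c.comp k) d' := by
  obtain ⟨l', h1, h2, -⟩ := exists_comp_eq_X hl
  obtain ⟨k', h3, h4, -⟩ := exists_comp_eq_X hk
  exact ⟨l'.comp b, k'.comp d, X, l, l', X, k, k', by simp [*]⟩

lemma comp_eq (h : RittEquiv a b c d a' b' c' d') (heq : a.comp b = c.comp d) :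
    a'.comp b' = c'.comp d' := by
  obtain ⟨k₁, k₂, k₂i, k₃, k₄, k₄i, e₁, e₂, e₃, e₄, f₁, f₂, f₃, f₄, rfl, rfl, rfl, rfl⟩ := h
  have aux : ∀ {p q k ki : ℂ[X]}, k.comp ki = X →
      (k₁.comp (p.comp k)).comp (ki.comp (q.comp k₃)) = k₁.comp ((p.comp q).comp k₃) := by
    intro p q k ki hk
    rw [comp_assoc, comp_assoc p, ← comp_assoc k, hk, X_comp, comp_assoc]
  rw [aux f₁, aux f₃, heq]

lemma natDegree_eq (h : RittEquiv a b c d a' b' c' d') :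
    b'.natDegree = b.natDegree ∧ d'.natDegree = d.natDegree := by
  obtain ⟨k₁, k₂, k₂i, k₃, k₄, k₄i, e₁, e₂, e₃, e₄, f₁, f₂, f₃, f₄, rfl, rfl, rfl, rfl⟩ := h
  simp [natDegree_comp, natDegree_eq_one_of_comp_eq_X f₁, natDegree_eq_one_of_comp_eq_X f₃, e₃]

end RittEquiv

lemma sub_C_eq_prod {a : ℂ[X]} (ha : 0 < a.natDegree) (z : ℂ) :
    a - C z = C a.leadingCoeff * ∏ x ∈ fibre a z, (X - C x) ^ ramIdx a x := by
  have h := (IsAlgClosed.splits (a - C z)).eq_prod_roots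
  have hlead : (a - C z).leadingCoeff = a.leadingCoeff :=
    leadingCoeff_sub_of_degree_lt (degree_C_le.trans_lt (natDegree_pos_iff_degree_pos.1 ha))
  rw [hlead, Finset.prod_multiset_map_count] at h
  rw [h]
  congr 1
  refine Finset.prod_congr rfl fun x hx => ?_
  rw [count_roots, ramIdx, (mem_fibre ha).1 hx]

lemma exists_C_mul_of_pow_eq_pow {p q : ℂ[X]} {n : ℕ} (hn : n ≠ 0) (h : p ^ n = q ^ n) :
    ∃ w : ℂ, w ^ n = 1 ∧ p = C w * q := by
  rcases eq_or_ne q 0 with rfl | hq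
  · exact ⟨1, one_pow _, by rw [zero_pow hn] at h; simpa using pow_eq_zero_iff hn |>.1 h⟩
  obtain ⟨r, rfl⟩ := (UniqueFactorizationMonoid.pow_dvd_pow_iff_dvd hn).1 h.symm.dvd
  have hr : r ^ n = 1 := by
    rw [mul_pow] at h
    exact mul_left_cancel₀ (pow_ne_zero n hq) (by rw [h, mul_one])
  have hdeg := congrArg natDegree hr
  rw [natDegree_pow, natDegree_one, mul_eq_zero, or_iff_right hn] at hdeg
  obtain ⟨w, rfl⟩ := natDegree_eq_zero.1 hdeg
  exact ⟨w, C_injective (by simpa using hr), mul_comm _ _⟩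

/-- In a solution of `b ^ n = d ^ s * h(d) ^ n`, the polynomial `d` is a power. -/
lemma exists_eq_C_mul_pow {b d h : ℂ[X]} {n s : ℕ} (hn : 0 < n) (hd : d.natDegree = n)
    (hs : Nat.Coprime s n) (hh : ¬ X ∣ h) (heq : b ^ n = d ^ s * (h.comp d) ^ n) :
    ∃ κ t : ℂ, κ ≠ 0 ∧ d = C κ * (X - C t) ^ n := by
  have hd0 : d ≠ 0 := ne_zero_of_natDegree_gt (hn.trans_eq hd.symm)
  obtain ⟨t, ht⟩ := IsAlgClosed.exists_root d
    (by rw [degree_eq_natDegree hd0, hd]; exact_mod_cast hn.ne')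
  have hroot : (h.comp d).eval t ≠ 0 := by
    rw [eval_comp, ht]
    rwa [X_dvd_iff, coeff_zero_eq_eval_zero] at hh
  have hc0 : h.comp d ≠ 0 := by
    intro h0
    simp [h0] at hroot
  have hmul := congrArg (fun p => p.roots.count t) heq
  simp only [roots_mul (mul_ne_zero (pow_ne_zero s hd0) (pow_ne_zero n hc0)), roots_pow,
    Multiset.count_add, Multiset.count_nsmul, count_roots, rootMultiplicity_eq_zero hroot] at hmul
  have hdvd : n ∣ d.rootMultiplicity t :=
    hs.symm.dvd_of_dvd_mul_left (Dvd.intro _ (by simpa using hmul))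
  have hpow : (X - C t) ^ n ∣ d :=
    (pow_dvd_pow _ (Nat.le_of_dvd ((rootMultiplicity_pos hd0).2 ht) hdvd)).trans
      (pow_rootMultiplicity_dvd d t)
  obtain ⟨q, hq⟩ := hpow
  have hq0 : q ≠ 0 := by
    rintro rfl
    simp [hd0] at hq
  have hdeg := congrArg natDegree hq
  rw [natDegree_mul (pow_ne_zero n (X_sub_C_ne_zero t)) hq0, natDegree_pow, natDegree_X_sub_C,
    hd] at hdeg
  obtain ⟨κ, rfl⟩ := natDegree_eq_zero.1 (show q.natDegree = 0 by omega)
  exact ⟨κ, t, fun h0 => hq0 (by rw [h0, C_0]), by rw [hq, mul_comm]⟩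

lemma exists_rittEquiv_pow {b d h : ℂ[X]} {n s : ℕ} (hn : 0 < n) (hd : d.natDegree = n)
    (hs : Nat.Coprime s n) (hh : ¬ X ∣ h) (heq : (X ^ n).comp b = (X ^ s * h ^ n).comp d) :
    RittEquiv (X ^ n) b (X ^ s * h ^ n) d (X ^ n) (X ^ s * h.comp (X ^ n)) (X ^ s * h ^ n)
      (X ^ n) := by
  obtain ⟨κ, t, hκ, hdt⟩ := exists_eq_C_mul_pow (b := b) hn hd hs hh (by simpa using heq)
  obtain ⟨τ, hτ⟩ := IsAlgClosed.exists_pow_nat_eq κ⁻¹ hn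
  have hτ0 : τ ≠ 0 := by
    rintro rfl
    rw [zero_pow hn.ne'] at hτ
    exact inv_ne_zero hκ hτ.symm
  have hl : (C τ * X + C t).natDegree = 1 := natDegree_linear hτ0
  have h1 := RittEquiv.right (X ^ n) b (X ^ s * h ^ n) d hl
  have hd1 : d.comp (C τ * X + C t) = X ^ n := by
    rw [hdt]
    simp only [mul_comp, C_comp, pow_comp, sub_comp, X_comp, add_sub_cancel_right]
    rw [mul_pow, ← mul_assoc, ← C_pow, ← C_mul, hτ, mul_inv_cancel₀ hκ, C_1, one_mul]
  rw [hd1] at h1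
  have heq1 := h1.comp_eq heq
  obtain ⟨w, hw, hbw⟩ := exists_C_mul_of_pow_eq_pow (p := b.comp (C τ * X + C t))
    (q := X ^ s * h.comp (X ^ n)) hn.ne' (by
      simp only [mul_comp, pow_comp, X_comp] at heq1
      rw [heq1]; ring)
  have hw0 : w ≠ 0 := by
    rintro rfl
    rw [zero_pow hn.ne'] at hw
    exact zero_ne_one hw
  refine h1.trans ⟨X, C w * X, C w⁻¹ * X, X, X, X, ?_⟩
  rw [hbw]
  refine ⟨natDegree_X, natDegree_C_mul_X _ hw0, natDegree_X, natDegree_X, ?_⟩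
  simp only [X_comp, comp_X, mul_comp, C_comp, pow_comp, mul_pow, ← mul_assoc, ← C_mul, ← C_pow,
    hw, mul_inv_cancel₀ hw0, inv_mul_cancel₀ hw0, C_1, one_mul, and_true]

/-- The two normal forms of a solution of `a ∘ b = c ∘ d`. -/
def IsRitt (a b c d : ℂ[X]) : Prop :=
  (∃ m n : ℕ, 0 < m ∧ 0 < n ∧ Nat.Coprime m n ∧
    RittEquiv a b c d (chebT n) (chebT m) (chebT m) (chebT n)) ∨
  ∃ (n s : ℕ) (h : ℂ[X]), 0 < n ∧ Nat.Coprime s n ∧ ¬ X ∣ h ∧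
    RittEquiv a b c d (X ^ n) (X ^ s * h.comp (X ^ n)) (X ^ s * h ^ n) (X ^ n)

lemma isRitt_of_natDegree_eq_one {a b c d : ℂ[X]} (ha : a.natDegree = 1) (hb : 0 < b.natDegree)
    (hd : d.natDegree = 1) (heq : a.comp b = c.comp d) : IsRitt a b c d := by
  obtain ⟨a', h1, h2, h3⟩ := exists_comp_eq_X ha
  obtain ⟨d', h4, h5, -⟩ := exists_comp_eq_X hd
  have hne : a.comp b ≠ 0 := ne_zero_of_natDegree_gt (n := 0) (by rw [natDegree_comp, ha]; omega)
  obtain ⟨h, hf, hh⟩ := exists_eq_pow_rootMultiplicity_mul_and_not_dvd _ hne 0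
  rw [C_0, sub_zero] at hf hh
  refine Or.inr ⟨1, (a.comp b).rootMultiplicity 0, h, one_pos, Nat.coprime_one_right _, hh,
    X, a', a, X, d, d', natDegree_X, h3, natDegree_X, hd, h2, h1, h4, h5, ?_⟩
  simp only [pow_one, comp_X, X_comp, h1, h5, ← heq, true_and, and_true, and_self]
  exact hf

lemma isRitt_of_isPowerType {a b c d : ℂ[X]} (ha : 0 < a.natDegree) (hc : 0 < c.natDegree)
    (hd : d.natDegree = a.natDegree) (heq : a.comp b = c.comp d)
    (hac : Nat.Coprime a.natDegree c.natDegree) {s : Finset ℂ}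
    (h : IsPowerType s (fibre a) (fibre c) (ramIdx c) a.natDegree) : IsRitt a b c d := by
  classical
  obtain ⟨z, -, hcard, y₀, hy₀, hdvd⟩ := h
  set n := a.natDegree with hn
  obtain ⟨x₀, hx₀⟩ := Finset.card_eq_one.1 hcard
  have hfa := sub_C_eq_prod ha z
  have hex := sum_ramIdx ha z
  rw [hx₀, Finset.sum_singleton, ← hn] at hex
  rw [hx₀, Finset.prod_singleton, hex] at hfa
  have hfc := sub_C_eq_prod hc z
  rw [← Finset.mul_prod_erase _ _ hy₀] at hfc
  have hdvd' : ∀ y ∈ (fibre c z).erase y₀, n ∣ ramIdx c y := fun y hy =>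
    hdvd y (Finset.mem_of_mem_erase hy) (Finset.ne_of_mem_erase hy)
  have hcop : Nat.Coprime (ramIdx c y₀) n := by
    have hsum := sum_ramIdx hc z
    rw [← Finset.add_sum_erase _ _ hy₀] at hsum
    obtain ⟨k, hk⟩ := Finset.dvd_sum hdvd'
    rw [hk] at hsum
    rw [← hsum] at hac
    simpa using hac.symm
  set H : ℂ[X] := ∏ y ∈ (fibre c z).erase y₀, (X - C y) ^ (ramIdx c y / n) with hH
  have hHn : ∏ y ∈ (fibre c z).erase y₀, (X - C y) ^ ramIdx c y = H ^ n := by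
    rw [hH, ← Finset.prod_pow]
    refine Finset.prod_congr rfl fun y hy => ?_
    rw [← pow_mul, Nat.div_mul_cancel (hdvd' y hy)]
  rw [hHn] at hfc
  have hHy : H.eval y₀ ≠ 0 := by
    rw [hH, eval_prod]
    refine Finset.prod_ne_zero_iff.2 fun y hy => ?_
    rw [eval_pow]
    refine pow_ne_zero _ ?_
    simpa [sub_eq_zero] using (Finset.ne_of_mem_erase hy).symm
  have hla : a.leadingCoeff ≠ 0 := leadingCoeff_ne_zero.2 (ne_zero_of_natDegree_gt ha)
  have hlc : c.leadingCoeff ≠ 0 := leadingCoeff_ne_zero.2 (ne_zero_of_natDegree_gt hc)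
  obtain ⟨ν, hν⟩ := IsAlgClosed.exists_pow_nat_eq a.leadingCoeff⁻¹ ha
  obtain ⟨μ, hμ⟩ := IsAlgClosed.exists_pow_nat_eq c.leadingCoeff ha
  have hν0 : ν ≠ 0 := by
    rintro rfl
    rw [zero_pow ha.ne'] at hν
    exact inv_ne_zero hla hν.symm
  have hμ0 : μ ≠ 0 := by
    rintro rfl
    rw [zero_pow ha.ne'] at hμ
    exact hlc hμ.symm
  have h1 := RittEquiv.left a b c d (natDegree_X_sub_C z)
  obtain ⟨b', d', h2⟩ := RittEquiv.mid ((X - C z).comp a) b ((X - C z).comp c) d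
    (natDegree_linear (b := x₀) hν0) (natDegree_X_add_C y₀)
  have h3 := h1.trans h2
  have hA : ((X - C z).comp a).comp (C ν * X + C x₀) = X ^ n := by
    rw [sub_comp, X_comp, C_comp, hfa]
    simp only [mul_comp, C_comp, pow_comp, sub_comp, X_comp, add_sub_cancel_right]
    rw [mul_pow, ← mul_assoc, ← C_pow, ← C_mul, hν, mul_inv_cancel₀ hla, C_1, one_mul]
  have hC : ((X - C z).comp c).comp (X + C y₀) =
      X ^ ramIdx c y₀ * (C μ * H.comp (X + C y₀)) ^ n := by
    rw [sub_comp, X_comp, C_comp, hfc]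
    simp only [mul_comp, C_comp, pow_comp, sub_comp, X_comp, add_sub_cancel_right]
    rw [mul_pow, ← C_pow, hμ]
    ring
  rw [hA, hC] at h3
  have hh : ¬ X ∣ C μ * H.comp (X + C y₀) := by
    rw [X_dvd_iff, coeff_zero_eq_eval_zero]
    simpa [eval_comp, hμ0] using hHy
  exact Or.inr ⟨n, _, _, ha, hcop, hh, h3.trans
    (exists_rittEquiv_pow ha (h3.natDegree_eq.2.trans hd) hcop hh (h3.comp_eq heq))⟩

/-- If the ramification indices over `z` and `w` are at most two, and exactly two of them are one,
then `(a - z) * (a - w)` is a quadratic polynomial times a square. -/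
lemma exists_mul_eq_mul_sq {a : ℂ[X]} (ha : 0 < a.natDegree) {z w : ℂ} (hzw : z ≠ w)
    (hz : ∀ x ∈ fibre a z, ramIdx a x ≤ 2) (hw : ∀ x ∈ fibre a w, ramIdx a x ≤ 2)
    (hcard : (fibre a z).card + (fibre a w).card = a.natDegree + 1) :
    ∃ (α β : ℂ) (g : ℂ[X]), α ≠ β ∧
      (a - C z) * (a - C w) = (X - C α) * (X - C β) * g ^ 2 := by
  classical
  have hdisj : Disjoint (fibre a z) (fibre a w) :=
    pairwiseDisjoint_fibre ha Set.univ (Set.mem_univ z) (Set.mem_univ w) hzw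
  set K := fibre a z ∪ fibre a w with hK
  have hKle : ∀ x ∈ K, ramIdx a x ≤ 2 := by
    intro x hx
    rcases Finset.mem_union.1 hx with h | h
    · exact hz x h
    · exact hw x h
  have hKcard : K.card = a.natDegree + 1 := by rw [hK, Finset.card_union_of_disjoint hdisj, hcard]
  have hKsum : ∑ x ∈ K, ramIdx a x = 2 * a.natDegree := by
    rw [hK, Finset.sum_union hdisj, sum_ramIdx ha, sum_ramIdx ha, two_mul]
  have hone : ∀ x ∈ K.filter fun x => ramIdx a x = 1, ramIdx a x = 1 := fun x hx =>
    (Finset.mem_filter.1 hx).2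
  have htwo : ∀ x ∈ K.filter fun x => ¬ ramIdx a x = 1, ramIdx a x = 2 := by
    intro x hx
    obtain ⟨h1, h2⟩ := Finset.mem_filter.1 hx
    have := hKle x h1
    have := ramIdx_pos ha x
    omega
  have hcard2 : (K.filter fun x => ramIdx a x = 1).card = 2 := by
    have h1 := Finset.card_filter_add_card_filter_not (s := K) (fun x => ramIdx a x = 1)
    have h2 := Finset.sum_filter_add_sum_filter_not K (fun x => ramIdx a x = 1) (ramIdx a)
    rw [Finset.sum_congr rfl hone, Finset.sum_congr rfl htwo] at h2
    simp only [Finset.sum_const, smul_eq_mul] at h2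
    omega
  obtain ⟨α, β, hαβ, hS⟩ := Finset.card_eq_two.1 hcard2
  refine ⟨α, β, C a.leadingCoeff * ∏ x ∈ K.filter fun x => ¬ ramIdx a x = 1, (X - C x), hαβ, ?_⟩
  have hprod : ∏ x ∈ K, (X - C x) ^ ramIdx a x = (X - C α) * (X - C β) *
      (∏ x ∈ K.filter fun x => ¬ ramIdx a x = 1, (X - C x)) ^ 2 := by
    rw [← Finset.prod_filter_mul_prod_filter_not K (fun x => ramIdx a x = 1),
      ← Finset.prod_pow, ← Finset.prod_pair (f := fun x => X - C x) hαβ, ← hS]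
    congr 1
    · exact Finset.prod_congr rfl fun x hx => by rw [hone x hx, pow_one]
    · exact Finset.prod_congr rfl fun x hx => by rw [htwo x hx]
  rw [hK, Finset.prod_union hdisj, ← hK] at hprod
  rw [sub_C_eq_prod ha z, sub_C_eq_prod ha w, mul_pow]
  linear_combination C a.leadingCoeff ^ 2 * hprod

/-- A polynomial with two branch points of Chebyshev type is a Chebyshev polynomial up to
linear changes of variables. -/
lemma exists_comp_eq_chebT {a : ℂ[X]} (ha : 0 < a.natDegree) {z w : ℂ} (hzw : z ≠ w)
    (hz : ∀ x ∈ fibre a z, ramIdx a x ≤ 2) (hw : ∀ x ∈ fibre a w, ramIdx a x ≤ 2)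
    (hcard : (fibre a z).card + (fibre a w).card = a.natDegree + 1) {l : ℂ[X]}
    (hl : l.natDegree = 1)
    (hlzw : (l - 2) * (l + 2) = C (l.leadingCoeff ^ 2) * ((X - C z) * (X - C w))) :
    ∃ k : ℂ[X], k.natDegree = 1 ∧ ((l.comp a).comp k = chebT a.natDegree ∨
      (l.comp a).comp k = -chebT a.natDegree) := by
  obtain ⟨α, β, g, hαβ, hg⟩ := exists_mul_eq_mul_sq ha hzw hz hw hcard
  have hv : (α - β) / 4 ≠ 0 := div_ne_zero (sub_ne_zero.2 hαβ) (by norm_num)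
  have hk : (C ((α - β) / 4) * X + C ((α + β) / 2)).natDegree = 1 := natDegree_linear hv
  set k := C ((α - β) / 4) * X + C ((α + β) / 2) with hkdef
  refine ⟨k, hk, ?_⟩
  have hdeg : ((l.comp a).comp k).natDegree = a.natDegree := by
    rw [natDegree_comp, natDegree_comp, hk, hl]; omega
  rw [← hdeg]
  refine eq_chebT_or_eq_neg_chebT (g := C (l.leadingCoeff * ((α - β) / 4)) * g.comp k)
    (by rw [hdeg]; exact ha) ?_
  have h1 := congrArg (fun p => (p.comp a).comp k) hlzw
  have h2 := congrArg (fun p => p.comp k) hg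
  simp only [mul_comp, sub_comp, add_comp, X_comp, C_comp, pow_comp, ofNat_comp,
    Nat.cast_ofNat] at h1 h2
  have h3 : (k - C α) * (k - C β) = C ((α - β) / 4) ^ 2 * (X ^ 2 - 4) := by
    refine Polynomial.funext fun t => ?_
    simp only [hkdef, eval_mul, eval_sub, eval_add, eval_C, eval_X, eval_pow, eval_ofNat]
    ring
  rw [h2, h3] at h1
  simp only [C_mul, C_pow] at h1 ⊢
  linear_combination h1

lemma exists_linear_mul_eq {z w : ℂ} (hzw : z ≠ w) : ∃ l : ℂ[X], l.natDegree = 1 ∧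
    (l - 2) * (l + 2) = C (l.leadingCoeff ^ 2) * ((X - C z) * (X - C w)) := by
  have hzw' : z - w ≠ 0 := sub_ne_zero.2 hzw
  have hu : 4 / (z - w) ≠ 0 := div_ne_zero (by norm_num) hzw'
  refine ⟨C (4 / (z - w)) * X + C (-2 * (z + w) / (z - w)), natDegree_linear hu, ?_⟩
  rw [leadingCoeff_linear hu]
  refine Polynomial.funext fun t => ?_
  simp only [eval_mul, eval_sub, eval_add, eval_C, eval_X, eval_ofNat]
  field_simp
  ring

/-- The sign ambiguities can be removed when one of the degrees is odd. -/
lemma exists_rittEquiv_chebT {a b c d : ℂ[X]} {m n : ℕ} (hn : Odd n)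
    (ha : a = chebT n ∨ a = -chebT n) (hc : c = chebT m ∨ c = -chebT m) :
    ∃ b' d', RittEquiv a b c d (chebT n) b' (chebT m) d' := by
  have hX : (-X : ℂ[X]).natDegree = 1 := by rw [natDegree_neg, natDegree_X]
  have key : ∀ a : ℂ[X], (a = chebT n ∨ a = -chebT n) →
      ∃ b' d', RittEquiv a b (chebT m) d (chebT n) b' (chebT m) d' := by
    rintro a (rfl | rfl)
    · simpa using RittEquiv.mid (chebT n) b (chebT m) d (natDegree_X (R := ℂ)) natDegree_X
    · simpa [chebT_comp_neg_X, hn.neg_one_pow] using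
        RittEquiv.mid (-chebT n) b (chebT m) d hX natDegree_X
  rcases hc with rfl | rfl
  · exact key a ha
  · obtain ⟨b', d', h⟩ := key (-a) (by rcases ha with rfl | rfl <;> simp)
    have h1 := RittEquiv.left a b (-chebT m) d hX
    simp only [neg_comp, X_comp, neg_neg] at h1
    exact ⟨b', d', h1.trans h⟩

lemma isRitt_of_isChebyshevType {a b c d : ℂ[X]} (ha : 0 < a.natDegree) (hc : 0 < c.natDegree)
    (hbc : b.natDegree = c.natDegree) (heq : a.comp b = c.comp d)
    (hac : Nat.Coprime a.natDegree c.natDegree) (hodd : Odd a.natDegree) {s : Finset ℂ}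
    (h : IsChebyshevType s (fibre a) (fibre c) (ramIdx a) (ramIdx c) a.natDegree c.natDegree) :
    IsRitt a b c d := by
  obtain ⟨z, -, w, -, hzw, ⟨ha1, ha2, ha3⟩, hc1, hc2, hc3⟩ := h
  obtain ⟨l, hl, hlzw⟩ := exists_linear_mul_eq hzw
  obtain ⟨k, hk, hka⟩ := exists_comp_eq_chebT ha hzw ha1 ha2 ha3 hl hlzw
  obtain ⟨k', hk', hkc⟩ := exists_comp_eq_chebT hc hzw hc1 hc2 hc3 hl hlzw
  have h1 := RittEquiv.left a b c d hl
  obtain ⟨b₁, d₁, h2⟩ := RittEquiv.mid (l.comp a) b (l.comp c) d hk hk'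
  obtain ⟨b₂, d₂, h3⟩ := exists_rittEquiv_chebT (b := b₁) (d := d₁) hodd hka hkc
  have h4 := (h1.trans h2).trans h3
  obtain ⟨r, hr, rfl, rfl⟩ := exists_comp_eq_of_chebT_comp_eq ha hc hac
    (h4.natDegree_eq.1.trans hbc) (h4.comp_eq heq)
  obtain ⟨r', hr1, -, hr'⟩ := exists_comp_eq_X hr
  have h5 := h4.trans (RittEquiv.right _ _ _ _ hr')
  rw [comp_assoc, comp_assoc, hr1, comp_X, comp_X] at h5
  exact Or.inl ⟨c.natDegree, a.natDegree, hc, ha, hac.symm, h5⟩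

lemma cast_sum_ramIdx_sub_one {a : ℂ[X]} (ha : 0 < a.natDegree) (s : Finset ℂ)
    (hs : ∀ x, (derivative a).IsRoot x → a.eval x ∈ s) :
    ∑ z ∈ s, ∑ x ∈ fibre a z, ((ramIdx a x : ℤ) - 1) = a.natDegree - 1 := by
  have h := congrArg (Nat.cast (R := ℤ)) (sum_fibre_ramIdx_sub_one ha s hs)
  rw [Nat.cast_sub ha, Nat.cast_one] at h
  rw [← h, Nat.cast_sum]
  refine Finset.sum_congr rfl fun z _ => ?_
  rw [Nat.cast_sum]
  refine Finset.sum_congr rfl fun x _ => ?_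
  rw [Nat.cast_sub (ramIdx_pos ha x), Nat.cast_one]

lemma cast_sum_sub_gcd_le {a b c d : ℂ[X]} (ha : 0 < a.natDegree) (hb : 0 < b.natDegree)
    (hc : 0 < c.natDegree) (hd : 0 < d.natDegree) (heq : a.comp b = c.comp d)
    (hbc : b.natDegree = c.natDegree) (hbd : Nat.Coprime b.natDegree d.natDegree) (s : Finset ℂ) :
    ∑ z ∈ s, ∑ y ∈ fibre c z, ∑ x ∈ fibre a z,
      ((ramIdx c y : ℤ) - Nat.gcd (ramIdx a x) (ramIdx c y)) ≤ c.natDegree - 1 := by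
  have h := Nat.cast_le (α := ℤ).2 (sum_sub_gcd_le a b c d ha hb hc hd heq hbc hbd s)
  rw [Nat.cast_sub hc, Nat.cast_one] at h
  refine le_trans (le_of_eq ?_) h
  simp only [Nat.cast_sum]
  refine Finset.sum_congr rfl fun z _ => Finset.sum_congr rfl fun y _ =>
    Finset.sum_congr rfl fun x _ => ?_
  rw [Nat.cast_sub (Nat.le_of_dvd (ramIdx_pos hc y) (Nat.gcd_dvd_right _ _))]

lemma exists_isRamData {a b c d : ℂ[X]} (ha : 2 ≤ a.natDegree) (hc : 2 ≤ c.natDegree)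
    (hda : d.natDegree = a.natDegree) (hbc : b.natDegree = c.natDegree)
    (heq : a.comp b = c.comp d) (hac : Nat.Coprime a.natDegree c.natDegree) :
    ∃ s : Finset ℂ, IsRamData s (fibre a) (fibre c) (ramIdx a) (ramIdx c) a.natDegree
      c.natDegree := by
  classical
  have ha0 : 0 < a.natDegree := by omega
  have hc0 : 0 < c.natDegree := by omega
  have hmem : ∀ {p : ℂ[X]}, 0 < p.natDegree → ∀ x, (derivative p).IsRoot x →
      p.eval x ∈ (derivative p).roots.toFinset.image fun x => p.eval x := by
    intro p hp x hx
    have hp' : derivative p ≠ 0 := fun h => by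
      have := derivative_eq_zero.1 h
      omega
    exact Finset.mem_image_of_mem _ (Multiset.mem_toFinset.2 ((mem_roots hp').2 hx))
  refine ⟨(derivative a).roots.toFinset.image (fun x => a.eval x) ∪
    (derivative c).roots.toFinset.image fun x => c.eval x, ?_⟩
  exact
    { coprime := hac
      two_le_left := ha
      two_le_right := hc
      pos_left := fun z _ x _ => ramIdx_pos ha0 x
      pos_right := fun z _ x _ => ramIdx_pos hc0 x
      sum_left := fun z _ => sum_ramIdx ha0 z
      sum_right := fun z _ => sum_ramIdx hc0 z
      ram_left := cast_sum_ramIdx_sub_one ha0 _ fun x hx =>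
        Finset.mem_union_left _ (hmem ha0 x hx)
      ram_right := cast_sum_ramIdx_sub_one hc0 _ fun x hx =>
        Finset.mem_union_right _ (hmem hc0 x hx)
      genus_left := cast_sum_sub_gcd_le hc0 (by omega) ha0 (by omega) heq.symm hda
        (by rwa [hda, hbc]) _
      genus_right := cast_sum_sub_gcd_le ha0 (by omega) hc0 (by omega) heq hbc
        (by rw [hda, hbc]; exact hac.symm) _ }

lemma isRitt_or_isRitt {a b c d : ℂ[X]} (ha : 0 < a.natDegree) (hb : 0 < b.natDegree)
    (hc : 0 < c.natDegree) (hd : 0 < d.natDegree) (heq : a.comp b = c.comp d)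
    (hac : Nat.Coprime a.natDegree c.natDegree) (hbd : Nat.Coprime b.natDegree d.natDegree) :
    IsRitt a b c d ∨ IsRitt c d a b := by
  have hdeg := congrArg natDegree heq
  rw [natDegree_comp, natDegree_comp] at hdeg
  have hda : d.natDegree = a.natDegree :=
    Nat.dvd_antisymm (hbd.symm.dvd_of_dvd_mul_right (Dvd.intro_left _ hdeg.symm))
      (hac.dvd_of_dvd_mul_left (Dvd.intro _ hdeg))
  have hbc : b.natDegree = c.natDegree := by
    rw [hda, mul_comm c.natDegree] at hdeg
    exact Nat.eq_of_mul_eq_mul_left ha hdeg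
  by_cases ha1 : a.natDegree = 1
  · exact Or.inl (isRitt_of_natDegree_eq_one ha1 hb (hda.trans ha1) heq)
  by_cases hc1 : c.natDegree = 1
  · exact Or.inr (isRitt_of_natDegree_eq_one hc1 hd (hbc.trans hc1) heq.symm)
  obtain ⟨s, hs⟩ := exists_isRamData (by omega) (by omega) hda hbc heq hac
  rcases hs.isPowerType_or_isChebyshevType with h | h | h
  · exact Or.inl (isRitt_of_isPowerType ha hc hda heq hac h)
  · exact Or.inr (isRitt_of_isPowerType hc ha hbc heq.symm hac.symm h)
  · rcases Nat.even_or_odd a.natDegree with heven | hodd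
    · have hodd : Odd c.natDegree := by
        rw [← Nat.not_even_iff_odd]
        intro heven'
        have := Nat.dvd_gcd heven.two_dvd heven'.two_dvd
        rw [hac] at this
        omega
      exact Or.inr (isRitt_of_isChebyshevType hc ha hda heq.symm hac.symm hodd h.symm)
    · exact Or.inl (isRitt_of_isChebyshevType ha hc hbc heq hac hodd h)

theorem ritt_second_theorem
    (a b c d : ℂ[X])
    (ha : 0 < a.natDegree) (hb : 0 < b.natDegree)
    (hc : 0 < c.natDegree) (hd : 0 < d.natDegree)
    (heq : a.comp b = c.comp d)
    (hac : Nat.gcd a.natDegree c.natDegree = 1)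
    (hbd : Nat.gcd b.natDegree d.natDegree = 1) :
    ∃ ℓ₁ ℓ₂ ℓ₂inv ℓ₃ ℓ₄ ℓ₄inv : ℂ[X],
      ℓ₁.natDegree = 1 ∧ ℓ₂.natDegree = 1 ∧ ℓ₃.natDegree = 1 ∧ ℓ₄.natDegree = 1 ∧
      ℓ₂.comp ℓ₂inv = Polynomial.X ∧ ℓ₂inv.comp ℓ₂ = Polynomial.X ∧
      ℓ₄.comp ℓ₄inv = Polynomial.X ∧ ℓ₄inv.comp ℓ₄ = Polynomial.X ∧
      ∃ a' b' c' d' : ℂ[X],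
        ((a', b', c', d') = (a, b, c, d) ∨ (a', b', c', d') = (c, d, a, b)) ∧
        ((∃ m n : ℕ, 0 < m ∧ 0 < n ∧ Nat.Coprime m n ∧
            ℓ₁.comp (a'.comp ℓ₂) = chebT n ∧
            ℓ₂inv.comp (b'.comp ℓ₃) = chebT m ∧
            ℓ₁.comp (c'.comp ℓ₄) = chebT m ∧
            ℓ₄inv.comp (d'.comp ℓ₃) = chebT n) ∨
         (∃ (n s : ℕ) (h : ℂ[X]), 0 < n ∧ Nat.Coprime s n ∧ ¬ (Polynomial.X ∣ h) ∧
            ℓ₁.comp (a'.comp ℓ₂) = Polynomial.X ^ n ∧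
            ℓ₂inv.comp (b'.comp ℓ₃) = Polynomial.X ^ s * h.comp (Polynomial.X ^ n) ∧
            ℓ₁.comp (c'.comp ℓ₄) = Polynomial.X ^ s * h ^ n ∧
            ℓ₄inv.comp (d'.comp ℓ₃) = Polynomial.X ^ n)) := by
  rcases isRitt_or_isRitt ha hb hc hd heq hac hbd with h | h
  · rcases h with ⟨m, n, hm, hn, hmn, ℓ₁, ℓ₂, ℓ₂inv, ℓ₃, ℓ₄, ℓ₄inv, e₁, e₂, e₃, e₄,
      f₁, f₂, f₃, f₄, hcomp⟩ | ⟨n, s, p, hn, hs, hp, ℓ₁, ℓ₂, ℓ₂inv, ℓ₃, ℓ₄, ℓ₄inv,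
      e₁, e₂, e₃, e₄, f₁, f₂, f₃, f₄, hcomp⟩
    · exact ⟨ℓ₁, ℓ₂, ℓ₂inv, ℓ₃, ℓ₄, ℓ₄inv, e₁, e₂, e₃, e₄, f₁, f₂, f₃, f₄, a, b, c, d,
        Or.inl rfl, Or.inl ⟨m, n, hm, hn, hmn, hcomp⟩⟩
    · exact ⟨ℓ₁, ℓ₂, ℓ₂inv, ℓ₃, ℓ₄, ℓ₄inv, e₁, e₂, e₃, e₄, f₁, f₂, f₃, f₄, a, b, c, d,
        Or.inl rfl, Or.inr ⟨n, s, p, hn, hs, hp, hcomp⟩⟩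
  · rcases h with ⟨m, n, hm, hn, hmn, ℓ₁, ℓ₂, ℓ₂inv, ℓ₃, ℓ₄, ℓ₄inv, e₁, e₂, e₃, e₄,
      f₁, f₂, f₃, f₄, hcomp⟩ | ⟨n, s, p, hn, hs, hp, ℓ₁, ℓ₂, ℓ₂inv, ℓ₃, ℓ₄, ℓ₄inv,
      e₁, e₂, e₃, e₄, f₁, f₂, f₃, f₄, hcomp⟩
    · exact ⟨ℓ₁, ℓ₂, ℓ₂inv, ℓ₃, ℓ₄, ℓ₄inv, e₁, e₂, e₃, e₄, f₁, f₂, f₃, f₄, c, d, a, b,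
        Or.inr rfl, Or.inl ⟨m, n, hm, hn, hmn, hcomp⟩⟩
    · exact ⟨ℓ₁, ℓ₂, ℓ₂inv, ℓ₃, ℓ₄, ℓ₄inv, e₁, e₂, e₃, e₄, f₁, f₂, f₃, f₄, c, d, a, b,
        Or.inr rfl, Or.inr ⟨n, s, p, hn, hs, hp, hcomp⟩⟩
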